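/- arXiv:2407.07272 — 2 statements merged into one kernel-verified Lean document; each statement's English description precedes it below -/
import Mathlib

section
/- Let F be a Finsler metric on a nonempty open set U ⊆ ℝ² (n = 2) whose induced spray G has constant flag curvature K, i.e. R^i_k = K(F² δ^i_k − F F_{·k} y^i) for a constant K. Then for every volume form dV on U, the Berwald–Weyl curvature of (G,dV) vanishes: W^o_k = 0 for all k. -/
open scoped BigOperators
open MeasureTheory

noncomputable section BerwaldWeyl

/-- Points/vectors in local coordinates on `ℝⁿ`. -/
abbrev Vec (n : ℕ) := Fin n → ℝ

/-- Partial derivative in the base (`x`) variable along the `i`-th coordinate. -/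
def pdx {n : ℕ} (f : Vec n → Vec n → ℝ) (i : Fin n) : Vec n → Vec n → ℝ :=
  fun x y => fderiv ℝ (fun x' => f x' y) x (Pi.single i 1)

/-- Vertical derivative `f_{·i} = ∂f/∂y^i`. -/
def pdy {n : ℕ} (f : Vec n → Vec n → ℝ) (i : Fin n) : Vec n → Vec n → ℝ :=
  fun x y => fderiv ℝ (fun y' => f x y') y (Pi.single i 1)

/-- The slit fiber `ℝⁿ \ {0}`. -/
def slit (n : ℕ) : Set (Vec n) := {y | y ≠ 0}

/-- A spray on `U ⊆ ℝⁿ`: a family `G^i(x,y)`, smooth on `U × (ℝⁿ \ {0})` and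
positively 2-homogeneous in `y`. -/
def IsSpray {n : ℕ} (U : Set (Vec n)) (G : Fin n → Vec n → Vec n → ℝ) : Prop :=
  (∀ i, ContDiffOn ℝ (⊤ : ℕ∞) (fun p : Vec n × Vec n => G i p.1 p.2) (U ×ˢ slit n)) ∧
  (∀ i, ∀ x ∈ U, ∀ y ∈ slit n, ∀ c : ℝ, 0 < c → G i x (c • y) = c ^ 2 * G i x y)

/-- Nonlinear connection coefficients `N^i_j := ∂G^i/∂y^j`. -/
def Nc {n : ℕ} (G : Fin n → Vec n → Vec n → ℝ) (i j : Fin n) : Vec n → Vec n → ℝ :=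
  pdy (G i) j

/-- Berwald connection coefficients `Γ^i_{jk} := ∂²G^i/∂y^j∂y^k`. -/
def Γc {n : ℕ} (G : Fin n → Vec n → Vec n → ℝ) (i j k : Fin n) : Vec n → Vec n → ℝ :=
  pdy (pdy (G i) j) k

/-- Horizontal derivative of a scalar: `f_{|k} := δf/δx^k = ∂f/∂x^k - N^l_k ∂f/∂y^l`. -/
def hD {n : ℕ} (G : Fin n → Vec n → Vec n → ℝ) (f : Vec n → Vec n → ℝ) (k : Fin n) :
    Vec n → Vec n → ℝ :=
  fun x y => pdx f k x y - ∑ l, Nc G l k x y * pdy f l x y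

/-- Horizontal covariant derivative `A_{j|m}` of a 1-form `A_j`. -/
def covD1 {n : ℕ} (G : Fin n → Vec n → Vec n → ℝ) (A : Fin n → Vec n → Vec n → ℝ)
    (j m : Fin n) : Vec n → Vec n → ℝ :=
  fun x y => hD G (A j) m x y - ∑ l, A l x y * Γc G l j m x y

/-- Horizontal covariant derivative `A^i_{j|m}` of a (1,1)-tensor `A^i_j`. -/
def covD11 {n : ℕ} (G : Fin n → Vec n → Vec n → ℝ)
    (A : Fin n → Fin n → Vec n → Vec n → ℝ) (i j m : Fin n) : Vec n → Vec n → ℝ :=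
  fun x y => hD G (A i j) m x y + ∑ l, A l j x y * Γc G i l m x y
    - ∑ l, A i l x y * Γc G l j m x y

/-- Horizontal covariant derivative `B^i_{jk|m}` of a (1,2)-tensor `B^i_{jk}`. -/
def covD12 {n : ℕ} (G : Fin n → Vec n → Vec n → ℝ)
    (B : Fin n → Fin n → Fin n → Vec n → Vec n → ℝ) (i j k m : Fin n) : Vec n → Vec n → ℝ :=
  fun x y => hD G (B i j k) m x y + ∑ l, B l j k x y * Γc G i l m x y
    - ∑ l, B i l k x y * Γc G l j m x y - ∑ l, B i j l x y * Γc G l k m x y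

/-- Riemann curvature `R^i_k`. -/
def Riem {n : ℕ} (G : Fin n → Vec n → Vec n → ℝ) (i k : Fin n) : Vec n → Vec n → ℝ :=
  fun x y => 2 * pdx (G i) k x y - ∑ j, y j * pdy (pdx (G i) j) k x y
    + 2 * ∑ j, G j x y * Γc G i j k x y - ∑ s, Nc G i s x y * Nc G s k x y

/-- Ricci scalar `R := R^m_m/(n-1)`. -/
def Ricci {n : ℕ} (G : Fin n → Vec n → Vec n → ℝ) : Vec n → Vec n → ℝ :=
  fun x y => (∑ m, Riem G m m x y) / ((n : ℝ) - 1)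

/-- The Weyl-type curvature `T^i_k := R^i_k - (R δ^i_k - ½ R_{·k} y^i)`. -/
def Tcurv {n : ℕ} (G : Fin n → Vec n → Vec n → ℝ) (i k : Fin n) : Vec n → Vec n → ℝ :=
  fun x y => Riem G i k x y -
    (Ricci G x y * (if i = k then 1 else 0) - (1/2) * pdy (Ricci G) k x y * y i)

/-- The χ-curvature `χ_i := -(1/3) T^m_{i·m}`. -/
def chiC {n : ℕ} (G : Fin n → Vec n → Vec n → ℝ) (i : Fin n) : Vec n → Vec n → ℝ :=
  fun x y => -(1/3) * ∑ m, pdy (Tcurv G m i) m x y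

/-- The Weyl curvature `W^i_k := T^i_k + (3χ_k/(n+1)) y^i`. -/
def Weyl {n : ℕ} (G : Fin n → Vec n → Vec n → ℝ) (i k : Fin n) : Vec n → Vec n → ℝ :=
  fun x y => Tcurv G i k x y + (3 * chiC G k x y / ((n : ℝ) + 1)) * y i

/-- A volume form `dV = σ(x) dx` on `U`: `σ` smooth and positive. -/
def IsVolumeForm {n : ℕ} (U : Set (Vec n)) (σ : Vec n → ℝ) : Prop :=
  ContDiffOn ℝ (⊤ : ℕ∞) σ U ∧ ∀ x ∈ U, 0 < σ x

/-- The S-curvature of `(G, dV)`: `S := ∂G^m/∂y^m - y^m ∂(ln σ)/∂x^m`. -/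
def Scurv {n : ℕ} (G : Fin n → Vec n → Vec n → ℝ) (σ : Vec n → ℝ) : Vec n → Vec n → ℝ :=
  fun x y => ∑ m, Nc G m m x y
    - ∑ m, y m * fderiv ℝ (fun x' => Real.log (σ x')) x (Pi.single m 1)

/-- The projective spray `Ĝ^i := G^i - (S/(n+1)) y^i` of `(G, dV)`. -/
def Ghat {n : ℕ} (G : Fin n → Vec n → Vec n → ℝ) (σ : Vec n → ℝ) :
    Fin n → Vec n → Vec n → ℝ :=
  fun i x y => G i x y - (Scurv G σ x y / ((n : ℝ) + 1)) * y i

/-- The Berwald–Weyl curvature `W^o_k := R̂_{∥k} - ½ R̂_{·k∥m} y^m` of `(G, dV)`,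
where all hatted quantities and `∥` are taken with respect to the projective spray `Ĝ`. -/
def BWeyl {n : ℕ} (G : Fin n → Vec n → Vec n → ℝ) (σ : Vec n → ℝ) (k : Fin n) :
    Vec n → Vec n → ℝ :=
  fun x y => hD (Ghat G σ) (Ricci (Ghat G σ)) k x y
    - (1/2) * ∑ m, covD1 (Ghat G σ) (fun j => pdy (Ricci (Ghat G σ)) j) k m x y * y m

/-- The square `F²` of a Finsler metric. -/
def Fsq {n : ℕ} (F : Vec n → Vec n → ℝ) : Vec n → Vec n → ℝ := fun x y => (F x y) ^ 2

/-- The fundamental tensor `g_{ij}(x,y) := ½ ∂²(F²)/∂y^i∂y^j` as a matrix. -/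
def gmat {n : ℕ} (F : Vec n → Vec n → ℝ) (x y : Vec n) : Matrix (Fin n) (Fin n) ℝ :=
  fun i j => (1/2) * pdy (pdy (Fsq F) i) j x y

/-- A Finsler metric on `U`: smooth and positive on `U × (ℝⁿ \ {0})`, positively
1-homogeneous in `y`, with positive definite fundamental tensor. -/
def IsFinsler {n : ℕ} (U : Set (Vec n)) (F : Vec n → Vec n → ℝ) : Prop :=
  ContDiffOn ℝ (⊤ : ℕ∞) (fun p : Vec n × Vec n => F p.1 p.2) (U ×ˢ slit n) ∧
  (∀ x ∈ U, ∀ y ∈ slit n, 0 < F x y) ∧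
  (∀ x ∈ U, ∀ y ∈ slit n, ∀ c : ℝ, 0 < c → F x (c • y) = c * F x y) ∧
  (∀ x ∈ U, ∀ y ∈ slit n, (gmat F x y).PosDef)

/-- The spray induced by a Finsler metric:
`G^i := ¼ g^{il}([F²]_{x^k y^l} y^k − [F²]_{x^l})`. -/
def sprayF {n : ℕ} (F : Vec n → Vec n → ℝ) : Fin n → Vec n → Vec n → ℝ :=
  fun i x y => (1/4) * ∑ l, (gmat F x y)⁻¹ i l *
    (∑ k, y k * pdy (pdx (Fsq F) k) l x y - pdx (Fsq F) l x y)

/-- The Busemann–Hausdorff volume density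
`σ_BH(x) := vol(Bⁿ) / vol {y | F(x,y) < 1}`. -/
def sigmaBH {n : ℕ} (F : Vec n → Vec n → ℝ) (x : Vec n) : ℝ :=
  (volume {y : Vec n | ∑ i, (y i) ^ 2 < 1}).toReal /
    (volume {y : Vec n | F x y < 1}).toReal

/-- Coordinate vector fields `∂/∂x^i`, `∂/∂y^i` and fibre coordinates `y^i` on an abstract
algebra of functions of `(x, y) ∈ ℝ² × ℝ²`. -/
structure CoordFrame (A : Type*) [CommRing A] [Algebra ℝ A] where
  X : Fin 2 → Derivation ℝ A A
  Y : Fin 2 → Derivation ℝ A A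
  y : Fin 2 → A
  X_comm : ∀ i j a, X i (X j a) = X j (X i a)
  Y_comm : ∀ i j a, Y i (Y j a) = Y j (Y i a)
  X_Y : ∀ i j a, X i (Y j a) = Y j (X i a)
  X_y : ∀ i j, X i (y j) = 0
  Y_y : ∀ i j, Y i (y j) = if i = j then 1 else 0

namespace CoordFrame

variable {A : Type*} [CommRing A] [Algebra ℝ A] (C : CoordFrame A)

/-- The Euler field `y^m ∂/∂y^m`. -/
def euler (a : A) : A := ∑ m, C.y m * C.Y m a

/-- The spray vector field `y^m ∂/∂x^m - 2 G^l ∂/∂y^l`. -/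
def spray (G : Fin 2 → A) (a : A) : A := ∑ m, C.y m * C.X m a - 2 * ∑ l, G l * C.Y l a

/-- The horizontal field `δ/δx^k`. -/
def hor (G : Fin 2 → A) (k : Fin 2) (a : A) : A := C.X k a - ∑ l, C.Y k (G l) * C.Y l a

/-- The Riemann curvature `R^i_k` of the spray with coefficients `G`. -/
def riem (G : Fin 2 → A) (i k : Fin 2) : A :=
  2 * C.X k (G i) - ∑ j, C.y j * C.Y k (C.X j (G i)) + 2 * ∑ j, G j * C.Y k (C.Y j (G i))
    - ∑ s, C.Y s (G i) * C.Y k (G s)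

/-- The contraction `a_{·k|m} y^m`. -/
def contrCov (G : Fin 2 → A) (a : A) (k : Fin 2) : A :=
  ∑ m, (C.hor G m (C.Y k a) - ∑ l, C.Y l a * C.Y m (C.Y k (G l))) * C.y m

lemma Y_comm_one_zero (a : A) : C.Y 1 (C.Y 0 a) = C.Y 0 (C.Y 1 a) := C.Y_comm 1 0 a

lemma X_comm_one_zero (a : A) : C.X 1 (C.X 0 a) = C.X 0 (C.X 1 a) := C.X_comm 1 0 a

lemma derivation_two (D : Derivation ℝ A A) : D (2 : A) = 0 := by
  simpa using D.map_natCast 2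

lemma derivation_three (D : Derivation ℝ A A) : D (3 : A) = 0 := by
  simpa using D.map_natCast 3

lemma euler_Y (a : A) (k : Fin 2) : C.euler (C.Y k a) = C.Y k (C.euler a) - C.Y k a := by
  fin_cases k <;>
    simp [euler, Fin.sum_univ_two, C.Y_y, C.Y_comm_one_zero] <;> ring

lemma Y_spray (G : Fin 2 → A) (a : A) (k : Fin 2) :
    C.Y k (C.spray G a) =
      C.spray G (C.Y k a) + C.hor G k a - ∑ l, C.Y k (G l) * C.Y l a := by
  fin_cases k <;>
    simp [spray, hor, Fin.sum_univ_two, C.Y_y, C.X_Y, C.Y_comm_one_zero, derivation_two] <;> ring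

lemma spray_hor (G : Fin 2 → A) (a : A) (k : Fin 2) :
    C.spray G (C.hor G k a) = C.hor G k (C.spray G a) + ∑ l, C.riem G l k * C.Y l a
      + ∑ l, C.Y k (G l) * C.hor G l a := by
  fin_cases k <;>
    simp [spray, hor, riem, Fin.sum_univ_two, C.X_y, C.Y_y, C.X_Y, C.Y_comm_one_zero,
      C.X_comm_one_zero, derivation_two] <;> ring

/-- The `χ`-curvature identity `2 R^m_{k·m} + R^m_{m·k} = 6 N_{|k} - 3 (N_{|m} y^m)_{·k}`
with `N = N^m_m`. -/
lemma riem_divergence (G : Fin 2 → A) (k : Fin 2) :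
    2 * ∑ m, C.Y m (C.riem G m k) + C.Y k (∑ m, C.riem G m m) =
      6 * C.hor G k (∑ m, C.Y m (G m)) - 3 * C.Y k (C.spray G (∑ m, C.Y m (G m))) := by
  fin_cases k <;>
    simp [spray, hor, riem, Fin.sum_univ_two, C.Y_y, C.X_Y, C.Y_comm_one_zero,
      derivation_two] <;> ring

lemma contrCov_eq {G : Fin 2 → A} (hG : ∀ i, C.euler (G i) = 2 * G i) (a : A) (k : Fin 2) :
    C.contrCov G a k = C.Y k (C.spray G a) - C.hor G k a := by
  have h := hG
  have h' : ∀ i j, C.y 0 * C.Y 0 (C.Y j (G i)) + C.y 1 * C.Y 1 (C.Y j (G i)) = C.Y j (G i) := by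
    intro i j
    have := C.euler_Y (G i) j
    rw [hG] at this
    simp [euler, Fin.sum_univ_two, derivation_two] at this
    linear_combination this
  rw [Y_spray]
  simp only [euler, Fin.sum_univ_two] at h
  simp only [contrCov, spray, hor, Fin.sum_univ_two]
  linear_combination - C.Y 0 a * h' 0 k - C.Y 1 a * h' 1 k - C.Y 0 (C.Y k a) * h 0
    - C.Y 1 (C.Y k a) * h 1

lemma two_mul_cancel {a b : A} (h : 2 * a = 2 * b) : a = b := by
  have h2 : algebraMap ℝ A (1 / 2) * 2 = 1 := by
    rw [← map_ofNat (algebraMap ℝ A) 2, ← map_mul]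
    norm_num
  linear_combination algebraMap ℝ A (1 / 2) * h - (a - b) * h2

lemma three_mul_cancel {a b : A} (h : 3 * a = 3 * b) : a = b := by
  have h3 : algebraMap ℝ A (1 / 3) * 3 = 1 := by
    rw [← map_ofNat (algebraMap ℝ A) 3, ← map_mul]
    norm_num
  linear_combination algebraMap ℝ A (1 / 3) * h - (a - b) * h3

lemma euler_spray {G : Fin 2 → A} (hG : ∀ i, C.euler (G i) = 2 * G i) (a : A) :
    C.euler (C.spray G a) = C.spray G (C.euler a) + C.spray G a := by
  have h0 := hG 0
  have h1 := hG 1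
  simp only [euler, Fin.sum_univ_two] at h0 h1
  simp [euler, spray, Fin.sum_univ_two, derivation_two, C.X_y, C.Y_y, C.X_Y, C.Y_comm_one_zero]
  linear_combination (-2) * C.Y 0 a * h0 - 2 * C.Y 1 a * h1

lemma euler_trace {G : Fin 2 → A} (hG : ∀ i, C.euler (G i) = 2 * G i) :
    C.euler (∑ m, C.Y m (G m)) = ∑ m, C.Y m (G m) := by
  have h : ∀ i, C.euler (C.Y i (G i)) = C.Y i (G i) := fun i => by
    rw [euler_Y, hG]
    simp [derivation_two]
    ring
  have h0 := h 0
  have h1 := h 1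
  simp only [euler, Fin.sum_univ_two, map_add] at h0 h1 ⊢
  linear_combination h0 + h1

lemma euler_Scurv {G : Fin 2 → A} {ℓ : A} (hG : ∀ i, C.euler (G i) = 2 * G i)
    (hℓ : ∀ k, C.Y k ℓ = 0) :
    C.euler (∑ m, C.Y m (G m) - ∑ m, C.y m * C.X m ℓ) =
      ∑ m, C.Y m (G m) - ∑ m, C.y m * C.X m ℓ := by
  have h := C.euler_trace hG
  have hXℓ : ∀ i j, C.Y i (C.X j ℓ) = 0 := fun i j => by rw [← C.X_Y, hℓ, map_zero]
  simp only [euler, Fin.sum_univ_two, map_add, map_sub] at h ⊢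
  simp [hXℓ, C.Y_y]
  linear_combination h

lemma spray_eq_sum_hor {G : Fin 2 → A} (hG : ∀ i, C.euler (G i) = 2 * G i) (a : A) :
    C.spray G a = ∑ m, C.y m * C.hor G m a := by
  have h0 := hG 0
  have h1 := hG 1
  simp only [euler, Fin.sum_univ_two] at h0 h1
  simp only [spray, hor, Fin.sum_univ_two]
  linear_combination C.Y 0 a * h0 + C.Y 1 a * h1

section ProjectiveChange

variable {G : Fin 2 → A} {P : A}

lemma euler_projective (hG : ∀ i, C.euler (G i) = 2 * G i) (hP : C.euler P = P) (i : Fin 2) :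
    C.euler (G i + P * C.y i) = 2 * (G i + P * C.y i) := by
  have h := hG i
  simp only [euler, Fin.sum_univ_two] at h hP ⊢
  fin_cases i <;> simp [C.Y_y] at h ⊢
  · linear_combination h + C.y 0 * hP
  · linear_combination h + C.y 1 * hP

lemma spray_projective (a : A) :
    C.spray (fun i => G i + P * C.y i) a = C.spray G a - 2 * P * C.euler a := by
  simp only [spray, euler, Fin.sum_univ_two]; ring

lemma hor_projective (a : A) (k : Fin 2) :
    C.hor (fun i => G i + P * C.y i) k a = C.hor G k a - C.Y k P * C.euler a - P * C.Y k a := by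
  fin_cases k <;> simp [hor, euler, Fin.sum_univ_two, C.Y_y] <;> ring

lemma riem_trace (G : Fin 2 → A) :
    ∑ m, C.riem G m m = 2 * ∑ m, C.X m (G m) - C.spray G (∑ m, C.Y m (G m))
      - ∑ m, ∑ s, C.Y s (G m) * C.Y m (G s) := by
  simp [spray, riem, Fin.sum_univ_two, C.X_Y, C.Y_comm_one_zero]
  ring

/-- Under the projective change `G^i + P y^i` the trace of the curvature changes by
`P² - P_{|m} y^m`. -/
lemma riem_trace_projective (hG : ∀ i, C.euler (G i) = 2 * G i) (hP : C.euler P = P) :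
    ∑ m, C.riem (fun i => G i + P * C.y i) m m = ∑ m, C.riem G m m + P ^ 2 - C.spray G P := by
  have hN : ∑ m, C.Y m (G m + P * C.y m) = ∑ m, C.Y m (G m) + 3 * P := by
    simp only [euler, Fin.sum_univ_two] at hP ⊢
    simp [C.Y_y]
    linear_combination hP
  have hEN := C.euler_trace hG
  have hNN : ∑ m, ∑ s, C.Y s (G m + P * C.y m) * C.Y m (G s + P * C.y s) =
      ∑ m, ∑ s, C.Y s (G m) * C.Y m (G s) + 2 * ∑ m, C.Y m P * C.euler (G m)
        + 2 * P * ∑ m, C.Y m (G m) + (C.euler P) ^ 2 + 2 * P * C.euler P + 2 * P ^ 2 := by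
    simp [euler, Fin.sum_univ_two, C.Y_y]
    ring
  have hX : ∑ m, C.X m (G m + P * C.y m) =
      ∑ m, C.X m (G m) + C.spray G P + 2 * ∑ m, G m * C.Y m P := by
    simp [spray, Fin.sum_univ_two, C.X_y]
    ring
  have hS : C.spray G (∑ m, C.Y m (G m) + 3 * P) =
      C.spray G (∑ m, C.Y m (G m)) + 3 * C.spray G P := by
    simp [spray, Fin.sum_univ_two, derivation_three]
    ring
  have hE3 : C.euler (∑ m, C.Y m (G m) + 3 * P) = ∑ m, C.Y m (G m) + 3 * P := by
    have h3 : C.euler (∑ m, C.Y m (G m) + 3 * P) =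
        C.euler (∑ m, C.Y m (G m)) + 3 * C.euler P := by
      simp [euler, Fin.sum_univ_two, derivation_three]
      ring
    rw [h3, hEN, hP]
  rw [riem_trace, riem_trace, spray_projective, hN, hE3, hNN, hX, hS, hP]
  simp only [hG, Fin.sum_univ_two]
  ring

/-- If the projective factor satisfies `P_{·k|m} y^m = P_{|k}` and `G` has constant flag
curvature, then the projectively changed spray has vanishing Berwald-Weyl curvature. -/
lemma berwaldWeyl_projective {L : A} {K : ℝ} (hG : ∀ i, C.euler (G i) = 2 * G i)
    (hP : C.euler P = P) (hχ : ∀ k, C.Y k (C.spray G P) = 2 * C.hor G k P)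
    (hEL : C.euler L = 2 * L) (hL : ∀ k, C.hor G k L = 0)
    (hR : ∀ i k, 2 * C.riem G i k =
      algebraMap ℝ A K * (2 * L * (if i = k then 1 else 0) - C.Y k L * C.y i))
    (k : Fin 2) :
    2 * C.hor (fun i => G i + P * C.y i) k (∑ m, C.riem (fun i => G i + P * C.y i) m m)
      - C.contrCov (fun i => G i + P * C.y i) (∑ m, C.riem (fun i => G i + P * C.y i) m m) k
      = 0 := by
  have hT : ∑ m, C.riem G m m = algebraMap ℝ A K * L := by
    refine two_mul_cancel ?_
    have h0 := hR 0 0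
    have h1 := hR 1 1
    simp only [euler, Fin.sum_univ_two] at hEL ⊢
    simp only [if_true] at h0 h1
    linear_combination h0 + h1 - algebraMap ℝ A K * hEL
  have hSL : C.spray G L = 0 := by
    rw [C.spray_eq_sum_hor hG]
    simp [hL]
  rw [C.contrCov_eq (C.euler_projective hG hP), spray_projective, hor_projective,
    C.riem_trace_projective hG hP, hT]
  set Q := C.spray G P with hQ
  have hEQ : C.euler Q = 2 * Q := by
    rw [hQ, C.euler_spray hG, hP]
    ring
  have hEf : C.euler (algebraMap ℝ A K * L + P ^ 2 - Q) =
      2 * (algebraMap ℝ A K * L + P ^ 2 - Q) := by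
    have : C.euler (algebraMap ℝ A K * L + P ^ 2 - Q) =
        algebraMap ℝ A K * C.euler L + 2 * P * C.euler P - C.euler Q := by
      simp [euler, Fin.sum_univ_two, pow_two]
      ring
    rw [this, hEL, hP, hEQ]
    ring
  have hSf : C.spray G (algebraMap ℝ A K * L + P ^ 2 - Q) = 2 * P * Q - C.spray G Q := by
    have : C.spray G (algebraMap ℝ A K * L + P ^ 2 - Q) =
        algebraMap ℝ A K * C.spray G L + 2 * P * C.spray G P - C.spray G Q := by
      simp [spray, Fin.sum_univ_two, pow_two]
      ring
    rw [this, hSL, ← hQ]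
    ring
  have hHf : C.hor G k (algebraMap ℝ A K * L + P ^ 2 - Q) =
      2 * P * C.hor G k P - C.hor G k Q := by
    have : C.hor G k (algebraMap ℝ A K * L + P ^ 2 - Q) =
        algebraMap ℝ A K * C.hor G k L + 2 * P * C.hor G k P - C.hor G k Q := by
      simp [hor, Fin.sum_univ_two, pow_two]
      ring
    rw [this, hL]
    ring
  have hYSQ : C.Y k (C.spray G Q) = 2 * C.spray G (C.hor G k P) + C.hor G k Q
      - 2 * ∑ l, C.Y k (G l) * C.hor G l P := by
    have h2 : C.spray G (2 * C.hor G k P) = 2 * C.spray G (C.hor G k P) := by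
      simp [spray, Fin.sum_univ_two, derivation_two]
      ring
    rw [Y_spray, hχ, h2]
    simp only [hχ, Fin.sum_univ_two]
    ring
  have hRP : 2 * ∑ l, C.riem G l k * C.Y l P =
      algebraMap ℝ A K * (2 * L * C.Y k P - C.Y k L * P) := by
    have h0 := hR 0 k
    have h1 := hR 1 k
    simp only [euler, Fin.sum_univ_two] at hP ⊢
    fin_cases k <;> simp at h0 h1 ⊢
    · linear_combination C.Y 0 P * h0 + C.Y 1 P * h1 - algebraMap ℝ A K * C.Y 0 L * hP
    · linear_combination C.Y 0 P * h0 + C.Y 1 P * h1 - algebraMap ℝ A K * C.Y 1 L * hP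
  have hSH := C.spray_hor G P k
  rw [← hQ] at hSH
  rw [hEf, hSf, hHf]
  simp only [map_sub, map_add, pow_two, Derivation.leibniz, smul_eq_mul, derivation_two,
    Derivation.map_algebraMap, hYSQ, hχ]
  linear_combination hRP + 2 * hSH

end ProjectiveChange

section SquareOfMetric

variable {G : Fin 2 → A} {L : A}

lemma hor_eq_zero (hEL : C.euler L = 2 * L)
    (hgeod : ∀ l, C.spray G (C.Y l L) = C.X l L) (k : Fin 2) : C.hor G k L = 0 := by
  refine two_mul_cancel ?_
  have hS : C.spray G L = 0 := by
    have h0 := hgeod 0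
    have h1 := hgeod 1
    have h2 : C.spray G (C.euler L) = 2 * C.spray G L := by
      rw [hEL]
      simp [spray, Fin.sum_univ_two, derivation_two]
      ring
    have h3 : C.spray G (C.euler L) = ∑ l, C.y l * C.spray G (C.Y l L)
        - 2 * ∑ l, G l * C.Y l L := by
      simp [spray, euler, Fin.sum_univ_two, C.X_y, C.Y_y]
      ring
    rw [h2] at h3
    simp only [hgeod] at h3
    simp only [spray] at h3 ⊢
    linear_combination h3
  have h := C.Y_spray G L k
  rw [hS, map_zero, hgeod] at h
  simp only [hor] at h ⊢
  linear_combination - h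

/-- Euler-Lagrange equations with a nondegenerate Hessian force 2-homogeneous spray
coefficients. -/
lemma spray_homogeneous {g h : Fin 2 → Fin 2 → A} (hEL : C.euler L = 2 * L)
    (hg : ∀ i l, 2 * g i l = C.Y l (C.Y i L))
    (hh : ∀ i j, ∑ l, h i l * g l j = if i = j then 1 else 0)
    (hG : ∀ l, 4 * ∑ i, g l i * G i = ∑ k, C.y k * C.Y l (C.X k L) - C.X l L) (i : Fin 2) :
    C.euler (G i) = 2 * G i := by
  have hEY : ∀ i, C.euler (C.Y i L) = C.Y i L := fun i => by
    rw [euler_Y, hEL]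
    simp [derivation_two]
    ring
  have hEg : ∀ i j, C.euler (C.Y i (C.Y j L)) = 0 := fun i j => by
    rw [euler_Y, hEY, sub_self]
  have hEX : ∀ i, C.euler (C.X i L) = 2 * C.X i L := fun i => by
    have := congrArg (C.X i) hEL
    simp only [euler, Fin.sum_univ_two] at this ⊢
    simp [derivation_two, C.X_y, C.X_Y] at this
    linear_combination this
  have hG' : ∀ l, 2 * ∑ i, C.Y i (C.Y l L) * G i
      = ∑ k, C.y k * C.Y l (C.X k L) - C.X l L := fun l => by
    rw [← hG]
    simp only [← hg, Fin.sum_univ_two]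
    ring
  have hsol : ∀ l, ∑ i, g l i * (C.euler (G i) - 2 * G i) = 0 := fun l => by
    refine two_mul_cancel (two_mul_cancel ?_)
    have h1 : C.euler (2 * ∑ i, C.Y i (C.Y l L) * G i) =
        2 * ∑ i, (C.euler (C.Y i (C.Y l L)) * G i + C.Y i (C.Y l L) * C.euler (G i)) := by
      simp [euler, Fin.sum_univ_two, derivation_two]
      ring
    have h2 : C.euler (∑ k, C.y k * C.Y l (C.X k L) - C.X l L) =
        ∑ k, (C.y k * C.Y l (C.X k L) + C.y k * C.euler (C.Y l (C.X k L)))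
          - C.euler (C.X l L) := by
      simp [euler, Fin.sum_univ_two, C.Y_y]
      ring
    have h3 : ∀ k, C.euler (C.Y l (C.X k L)) = C.Y l (C.X k L) := fun k => by
      rw [euler_Y, hEX]
      simp [derivation_two]
      ring
    have h4 := hG' l
    rw [hG', h2] at h1
    simp only [h3, hEX, hEg, Fin.sum_univ_two] at h1 h4 ⊢
    simp only [← hg] at h1 h4
    linear_combination - h1 - 2 * h4
  have h0 := hsol 0
  have h1 := hsol 1
  have hh0 := hh i 0
  have hh1 := hh i 1
  simp only [Fin.sum_univ_two] at h0 h1 hh0 hh1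
  fin_cases i <;> simp at hh0 hh1 ⊢
  · linear_combination h 0 0 * h0 + h 0 1 * h1 - (C.euler (G 0) - 2 * G 0) * hh0
      - (C.euler (G 1) - 2 * G 1) * hh1
  · linear_combination h 1 0 * h0 + h 1 1 * h1 - (C.euler (G 0) - 2 * G 0) * hh0
      - (C.euler (G 1) - 2 * G 1) * hh1

lemma spray_Y_of_metric {g : Fin 2 → Fin 2 → A} (hg : ∀ i l, 2 * g i l = C.Y l (C.Y i L))
    (hG : ∀ l, 4 * ∑ i, g l i * G i = ∑ k, C.y k * C.Y l (C.X k L) - C.X l L) (l : Fin 2) :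
    C.spray G (C.Y l L) = C.X l L := by
  have h := hG l
  simp only [spray, Fin.sum_univ_two, C.X_Y] at h ⊢
  linear_combination -h + 2 * G 0 * hg l 0 + 2 * G 1 * hg l 1

/-- The distortion identity `(S_{|m} y^m)_{·k} = 2 S_{|k}` for the `S`-curvature of a spray of
constant flag curvature, where `ℓ` is the logarithm of the volume density. -/
lemma Y_spray_Scurv {K : ℝ} {ℓ : A} (hℓ : ∀ k, C.Y k ℓ = 0)
    (hEL : C.euler L = 2 * L)
    (hR : ∀ i k, 2 * C.riem G i k =
      algebraMap ℝ A K * (2 * L * (if i = k then 1 else 0) - C.Y k L * C.y i)) (k : Fin 2) :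
    C.Y k (C.spray G (∑ m, C.Y m (G m) - ∑ m, C.y m * C.X m ℓ)) =
      2 * C.hor G k (∑ m, C.Y m (G m) - ∑ m, C.y m * C.X m ℓ) := by
  have hdiv := C.riem_divergence G k
  have hθ : C.Y k (C.spray G (∑ m, C.y m * C.X m ℓ)) = 2 * C.hor G k (∑ m, C.y m * C.X m ℓ) := by
    have hXℓ : ∀ i j, C.Y i (C.X j ℓ) = 0 := fun i j => by rw [← C.X_Y, hℓ, map_zero]
    have hXXℓ : ∀ i j l, C.Y i (C.X j (C.X l ℓ)) = 0 := fun i j l => by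
      rw [← C.X_Y, hXℓ, map_zero]
    fin_cases k <;>
      simp [spray, hor, Fin.sum_univ_two, C.X_y, C.Y_y, hXℓ, hXXℓ, derivation_two,
        C.X_comm_one_zero] <;> ring
  have hcurv : 2 * ∑ m, C.Y m (C.riem G m k) + C.Y k (∑ m, C.riem G m m) = 0 := by
    refine two_mul_cancel ?_
    have hd : ∀ m i j, 2 * C.Y m (C.riem G i j) = algebraMap ℝ A K *
        (2 * C.Y m L * (if i = j then 1 else 0) - C.Y m (C.Y j L) * C.y i
          - C.Y j L * (if m = i then 1 else 0)) := fun m i j => by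
      have h := congrArg (C.Y m) (hR i j)
      have hδ : C.Y m (if i = j then (1 : A) else 0) = 0 := by split_ifs <;> simp
      simp only [map_sub, Derivation.leibniz, smul_eq_mul, derivation_two,
        Derivation.map_algebraMap, C.Y_y, hδ] at h
      linear_combination h
    have hEY := C.euler_Y L k
    rw [hEL] at hEY
    simp only [map_add, Fin.sum_univ_two]
    have h00 := hd 0 0 k
    have h11 := hd 1 1 k
    have h0 := hd k 0 0
    have h1 := hd k 1 1
    simp only [euler, Fin.sum_univ_two] at hEY
    fin_cases k <;>
      simp [derivation_two, C.Y_comm_one_zero] at h00 h11 h0 h1 hEY ⊢ <;>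
      linear_combination 2 * h00 + 2 * h11 + h0 + h1 - 3 * algebraMap ℝ A K * hEY
  have hS : C.spray G (∑ m, C.Y m (G m) - ∑ m, C.y m * C.X m ℓ) =
      C.spray G (∑ m, C.Y m (G m)) - C.spray G (∑ m, C.y m * C.X m ℓ) := by
    simp [spray, Fin.sum_univ_two]
    ring
  have hH : C.hor G k (∑ m, C.Y m (G m) - ∑ m, C.y m * C.X m ℓ) =
      C.hor G k (∑ m, C.Y m (G m)) - C.hor G k (∑ m, C.y m * C.X m ℓ) := by
    simp [hor, Fin.sum_univ_two]
    ring
  rw [hS, hH, map_sub, hθ]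
  refine three_mul_cancel ?_
  linear_combination hdiv - hcurv

end SquareOfMetric
end CoordFrame

section SmoothFunctions

variable {E : Type*} [NormedAddCommGroup E] (O : TopologicalSpace.Opens E)

/-- Extension by zero of a function on an open set. -/
def zeroExt (f : O → ℝ) : E → ℝ := Function.extend Subtype.val f 0

variable {O}

lemma zeroExt_coe (f : O → ℝ) (p : O) : zeroExt O f p = f p :=
  Subtype.val_injective.extend_apply f 0 p

lemma zeroExt_of_mem (f : O → ℝ) {p : E} (hp : p ∈ O) : zeroExt O f p = f ⟨p, hp⟩ :=
  zeroExt_coe f ⟨p, hp⟩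

lemma zeroExt_of_notMem (f : O → ℝ) {p : E} (hp : p ∉ O) : zeroExt O f p = 0 :=
  Function.extend_apply' _ _ _ fun ⟨q, hq⟩ => hp (hq ▸ q.2)

lemma zeroExt_add (f g : O → ℝ) : zeroExt O (f + g) = zeroExt O f + zeroExt O g := by
  ext p
  by_cases hp : p ∈ O
  · simp [zeroExt_of_mem _ hp]
  · simp [zeroExt_of_notMem _ hp]

lemma zeroExt_mul (f g : O → ℝ) : zeroExt O (f * g) = zeroExt O f * zeroExt O g := by
  ext p
  by_cases hp : p ∈ O
  · simp [zeroExt_of_mem _ hp]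
  · simp [zeroExt_of_notMem _ hp]

lemma zeroExt_smul (c : ℝ) (f : O → ℝ) : zeroExt O (c • f) = c • zeroExt O f := by
  ext p
  by_cases hp : p ∈ O
  · simp [zeroExt_of_mem _ hp]
  · simp [zeroExt_of_notMem _ hp]

variable [NormedSpace ℝ E]

variable (O) in
/-- The algebra of smooth functions on an open set. -/
def smoothFun : Subalgebra ℝ (O → ℝ) where
  carrier := {f | ContDiffOn ℝ (⊤ : ℕ∞) (zeroExt O f) O}
  mul_mem' {f g} hf hg := by
    rw [Set.mem_ofPred_eq, zeroExt_mul]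
    exact ContDiffOn.mul hf hg
  add_mem' {f g} hf hg := by
    rw [Set.mem_ofPred_eq, zeroExt_add]
    exact ContDiffOn.add hf hg
  algebraMap_mem' c :=
    (contDiffOn_const (c := c)).congr fun p hp => zeroExt_of_mem (O := O) _ hp

lemma contDiffOn_zeroExt (a : smoothFun O) : ContDiffOn ℝ (⊤ : ℕ∞) (zeroExt O a) O := a.2

lemma contDiffAt_zeroExt (a : smoothFun O) (p : O) :
    ContDiffAt ℝ (⊤ : ℕ∞) (zeroExt O a) p :=
  (contDiffOn_zeroExt a).contDiffAt (O.isOpen.mem_nhds p.2)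

lemma differentiableAt_zeroExt (a : smoothFun O) (p : O) :
    DifferentiableAt ℝ (zeroExt O a) p :=
  (contDiffAt_zeroExt a p).differentiableAt (by simp)

lemma contDiffOn_fderiv_zeroExt (a : smoothFun O) (v : E) :
    ContDiffOn ℝ (⊤ : ℕ∞) (fun p => fderiv ℝ (zeroExt O a) p v) O :=
  ((contDiffOn_zeroExt a).fderiv_of_isOpen O.isOpen (by simp)).clm_apply contDiffOn_const

/-- The derivative of smooth functions in a constant direction. -/
def dirDeriv (v : E) : Derivation ℝ (smoothFun O) (smoothFun O) :=
  Derivation.mk'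
    { toFun := fun a => ⟨fun p => fderiv ℝ (zeroExt O a) p v,
        (contDiffOn_fderiv_zeroExt a v).congr fun p hp => zeroExt_of_mem _ hp⟩
      map_add' := fun a b => Subtype.ext <| funext fun p => by
        simp [zeroExt_add, fderiv_add (differentiableAt_zeroExt a p) (differentiableAt_zeroExt b p)]
      map_smul' := fun c a => Subtype.ext <| funext fun p => by
        simp [zeroExt_smul, fderiv_const_smul (differentiableAt_zeroExt a p)] }
    fun a b => Subtype.ext <| funext fun p => by
      simp [zeroExt_mul, fderiv_mul (differentiableAt_zeroExt a p) (differentiableAt_zeroExt b p), zeroExt_coe]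

lemma dirDeriv_apply (v : E) (a : smoothFun O) (p : O) :
    (dirDeriv v a : O → ℝ) p = fderiv ℝ (zeroExt O a) p v := rfl

lemma two_le_infty : (2 : WithTop ℕ∞) ≤ ((⊤ : ℕ∞) : WithTop ℕ∞) :=
  WithTop.coe_le_coe.2 (le_top : (2 : ℕ∞) ≤ ⊤)

lemma dirDeriv_comm (v w : E) (a : smoothFun O) :
    dirDeriv v (dirDeriv w a) = dirDeriv w (dirDeriv v a) := by
  have key : ∀ (v w : E) (p : O), (dirDeriv v (dirDeriv w a) : O → ℝ) p =
      fderiv ℝ (fderiv ℝ (zeroExt O a)) p v w := fun v w p => by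
    have hd : DifferentiableAt ℝ (fderiv ℝ (zeroExt O a)) p :=
      ((contDiffAt_zeroExt a p).fderiv_right (m := 1) two_le_infty).differentiableAt (by simp)
    have he : zeroExt O (dirDeriv w a) =ᶠ[nhds (p : E)] fun q => fderiv ℝ (zeroExt O a) q w :=
      Filter.eventuallyEq_of_mem (O.isOpen.mem_nhds p.2) fun q hq => zeroExt_of_mem _ hq
    rw [dirDeriv_apply, he.fderiv_eq, fderiv_clm_apply hd (differentiableAt_const w)]
    simp
  ext p
  rw [key, key]
  exact (contDiffAt_zeroExt a p).isSymmSndFDerivAt (by simpa using two_le_infty) v w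

end SmoothFunctions

section Representation

variable {O : TopologicalSpace.Opens (Vec 2 × Vec 2)}

/-- The element `a` of the algebra of smooth functions on `O` is the restriction of `f`. -/
def Represents (f : Vec 2 → Vec 2 → ℝ) (a : smoothFun O) : Prop :=
  ∀ x y, ∀ h : (x, y) ∈ O, (a : O → ℝ) ⟨(x, y), h⟩ = f x y

namespace Represents

variable {f g : Vec 2 → Vec 2 → ℝ} {a b : smoothFun O}

lemma eq (ha : Represents f a) (hb : Represents f b) : a = b :=
  Subtype.ext <| funext fun ⟨⟨x, y⟩, h⟩ => (ha x y h).trans (hb x y h).symm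

lemma congr (ha : Represents f a) (hfg : ∀ x y, (x, y) ∈ O → g x y = f x y) : Represents g a :=
  fun x y h => (ha x y h).trans (hfg x y h).symm

lemma const (c : ℝ) : Represents (fun _ _ => c) (algebraMap ℝ (smoothFun O) c) := fun _ _ _ => rfl

lemma ofNat (n : ℕ) [n.AtLeastTwo] :
    Represents (fun _ _ => ofNat(n)) (OfNat.ofNat n : smoothFun O) := fun _ _ _ => rfl

lemma add (ha : Represents f a) (hb : Represents g b) :
    Represents (fun x y => f x y + g x y) (a + b) :=
  fun x y h => congrArg₂ (· + ·) (ha x y h) (hb x y h)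

lemma sub (ha : Represents f a) (hb : Represents g b) :
    Represents (fun x y => f x y - g x y) (a - b) :=
  fun x y h => congrArg₂ (· - ·) (ha x y h) (hb x y h)

lemma mul (ha : Represents f a) (hb : Represents g b) :
    Represents (fun x y => f x y * g x y) (a * b) :=
  fun x y h => congrArg₂ (· * ·) (ha x y h) (hb x y h)

lemma sum {f : Fin 2 → Vec 2 → Vec 2 → ℝ} {a : Fin 2 → smoothFun O}
    (ha : ∀ i, Represents (f i) (a i)) :
    Represents (fun x y => ∑ i, f i x y) (∑ i, a i) := by
  simp only [Fin.sum_univ_two]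
  exact (ha 0).add (ha 1)

lemma zeroExt_eventuallyEq (ha : Represents f a) {x y : Vec 2} (h : (x, y) ∈ O) :
    zeroExt O a =ᶠ[nhds (x, y)] fun p => f p.1 p.2 :=
  Filter.eventuallyEq_of_mem (O.isOpen.mem_nhds h) fun p hp =>
    (zeroExt_of_mem _ hp).trans (ha p.1 p.2 hp)

lemma hasFDerivAt (ha : Represents f a) {x y : Vec 2} (h : (x, y) ∈ O) :
    HasFDerivAt (fun p : Vec 2 × Vec 2 => f p.1 p.2) (fderiv ℝ (zeroExt O a) (x, y)) (x, y) :=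
  (differentiableAt_zeroExt a ⟨(x, y), h⟩).hasFDerivAt.congr_of_eventuallyEq
    (ha.zeroExt_eventuallyEq h).symm

lemma pdx (ha : Represents f a) (i : Fin 2) :
    Represents (pdx f i) (dirDeriv (Pi.single i 1, 0) a) := fun x y h => by
  have h1 : HasFDerivAt (fun x' => f x' y) _ x :=
    HasFDerivAt.comp (g := fun p : Vec 2 × Vec 2 => f p.1 p.2) (f := fun x' => (x', y)) x (ha.hasFDerivAt h)
      (hasFDerivAt_prodMk_left x y)
  rw [_root_.pdx, h1.fderiv, dirDeriv_apply]
  simp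

lemma pdy (ha : Represents f a) (i : Fin 2) :
    Represents (pdy f i) (dirDeriv (0, Pi.single i 1) a) := fun x y h => by
  have h1 : HasFDerivAt (fun y' => f x y') _ y :=
    HasFDerivAt.comp (g := fun p : Vec 2 × Vec 2 => f p.1 p.2) (f := fun y' => (x, y')) y (ha.hasFDerivAt h)
      (hasFDerivAt_prodMk_right x y)
  rw [_root_.pdy, h1.fderiv, dirDeriv_apply]
  simp

end Represents

lemma exists_represents {f : Vec 2 → Vec 2 → ℝ}
    (hf : ContDiffOn ℝ (⊤ : ℕ∞) (fun p : Vec 2 × Vec 2 => f p.1 p.2) O) :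
    ∃ a : smoothFun O, Represents f a :=
  ⟨⟨fun p => f p.1.1 p.1.2, hf.congr fun _ hp => zeroExt_of_mem _ hp⟩, fun _ _ _ => rfl⟩

lemma Represents.exists_inv {f : Vec 2 → Vec 2 → ℝ} {a : smoothFun O} (ha : Represents f a)
    (hf : ∀ x y, (x, y) ∈ O → f x y ≠ 0) :
    ∃ b : smoothFun O, Represents (fun x y => (f x y)⁻¹) b := by
  refine exists_represents (ContDiffOn.inv ((contDiffOn_zeroExt a).congr fun _ hp => ?_) fun _ hp => hf _ _ hp)
  rw [zeroExt_of_mem _ hp, ha]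

end Representation

section Bridge

variable {O : TopologicalSpace.Opens (Vec 2 × Vec 2)}

/-- The fibre coordinate `y^i` as a smooth function on `O`. -/
def fibreCoord (O : TopologicalSpace.Opens (Vec 2 × Vec 2)) (i : Fin 2) : smoothFun O :=
  ⟨fun p => p.1.2 i, ContDiffOn.congr (f := fun p : Vec 2 × Vec 2 => p.2 i)
    (by fun_prop) fun _ hp => zeroExt_of_mem _ hp⟩

namespace Represents

lemma fibreCoord (i : Fin 2) : Represents (fun _ y => y i) (fibreCoord O i) := fun _ _ _ => rfl

end Represents

variable (O) in
/-- The frame of coordinate derivations on the algebra of smooth functions on `O`. -/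
def jetFrame : CoordFrame (smoothFun O) where
  X i := dirDeriv (Pi.single i 1, 0)
  Y i := dirDeriv (0, Pi.single i 1)
  y := fibreCoord O
  X_comm _ _ := dirDeriv_comm _ _
  Y_comm _ _ := dirDeriv_comm _ _
  X_Y _ _ := dirDeriv_comm _ _
  X_y i j := ((Represents.fibreCoord j).pdx i).eq fun x y _ => by simp [pdx]
  Y_y i j := ((Represents.fibreCoord j).pdy i).eq fun x y _ => by
    have h : HasFDerivAt (fun y' : Vec 2 => y' j) (ContinuousLinearMap.proj (R := ℝ) j) y :=
      hasFDerivAt_apply j y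
    rw [pdy, h.fderiv]
    split_ifs with hij
    · simp [hij]
    · simp [Ne.symm hij]

namespace Represents

variable {f : Vec 2 → Vec 2 → ℝ} {a : smoothFun O} {G : Fin 2 → Vec 2 → Vec 2 → ℝ}
  {b : Fin 2 → smoothFun O}

lemma jetFrame_X (ha : Represents f a) (i : Fin 2) :
    Represents (_root_.pdx f i) ((jetFrame O).X i a) := ha.pdx i

lemma jetFrame_Y (ha : Represents f a) (i : Fin 2) :
    Represents (_root_.pdy f i) ((jetFrame O).Y i a) := ha.pdy i

lemma jetFrame_y (i : Fin 2) : Represents (fun _ y => y i) ((jetFrame O).y i) := fun _ _ _ => rfl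

lemma kronecker (i j : Fin 2) : Represents (fun _ _ => if i = j then 1 else 0)
    (if i = j then 1 else 0 : smoothFun O) := fun x y hxy => by
  split_ifs <;> rfl

lemma hor (hG : ∀ i, Represents (G i) (b i)) (ha : Represents f a) (k : Fin 2) :
    Represents (hD G f k) ((jetFrame O).hor b k a) :=
  (ha.pdx k).sub (sum fun l => ((hG l).pdy k).mul (ha.pdy l))

lemma riem (hG : ∀ i, Represents (G i) (b i)) (i k : Fin 2) :
    Represents (Riem G i k) ((jetFrame O).riem b i k) :=
  ((((ofNat 2).mul ((hG i).pdx k)).sub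
    (sum fun j => (jetFrame_y j).mul (((hG i).pdx j).pdy k))).add
    ((ofNat 2).mul (sum fun j => (hG j).mul (((hG i).pdy j).pdy k)))).sub
    (sum fun s => ((hG i).pdy s).mul ((hG s).pdy k))

lemma ricci (hG : ∀ i, Represents (G i) (b i)) :
    Represents (Ricci G) (∑ m, (jetFrame O).riem b m m) :=
  (sum fun m => riem hG m m).congr fun x y _ => by
    norm_num [Ricci]

lemma contrCov (hG : ∀ i, Represents (G i) (b i)) (ha : Represents f a) (k : Fin 2) :
    Represents (fun x y => ∑ m, covD1 G (fun j => _root_.pdy f j) k m x y * y m)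
      ((jetFrame O).contrCov b a k) :=
  sum fun m => ((hor hG (ha.pdy k) m).sub
    (sum fun l => (ha.pdy l).mul (((hG l).pdy k).pdy m))).mul (jetFrame_y m)

end Represents

end Bridge

section Finsler

variable {O : TopologicalSpace.Opens (Vec 2 × Vec 2)}

lemma sum_mul_pdy_of_homogeneous {f : Vec 2 → Vec 2 → ℝ} {a : smoothFun O} {x y : Vec 2}
    (ha : Represents f a) (h : (x, y) ∈ O) (k : ℕ)
    (hf : ∀ c : ℝ, 0 < c → f x (c • y) = c ^ k * f x y) :
    ∑ m, y m * pdy f m x y = k * f x y := by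
  have h1 : HasFDerivAt (fun y' => f x y') _ y :=
    HasFDerivAt.comp (g := fun p : Vec 2 × Vec 2 => f p.1 p.2) (f := fun y' => (x, y')) y
      (ha.hasFDerivAt h) (hasFDerivAt_prodMk_right x y)
  have h2 : fderiv ℝ (fun y' => f x y') y y = ∑ m, y m * pdy f m x y := by
    conv_lhs => rw [← ContinuousLinearMap.coe_coe, LinearMap.pi_apply_eq_sum_univ]
    refine Finset.sum_congr rfl fun m _ => ?_
    rw [smul_eq_mul, pdy]
    have hm : (fun j => if m = j then (1 : ℝ) else 0) = Pi.single m 1 := by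
      ext j
      simp [Pi.single_apply, eq_comm]
    rw [hm, ContinuousLinearMap.coe_coe]
  have hl : HasDerivAt (fun c : ℝ => c • y) y 1 := by
    simpa using (hasDerivAt_id (1 : ℝ)).smul_const y
  have h3 : HasDerivAt (fun c : ℝ => f x (c • y)) (fderiv ℝ (fun y' => f x y') y y) 1 := by
    refine HasFDerivAt.comp_hasDerivAt (l := fun y' => f x y') (f := fun c : ℝ => c • y) 1 ?_ hl
    rw [one_smul]
    exact h1.differentiableAt.hasFDerivAt
  have h4 : HasDerivAt (fun c : ℝ => f x (c • y)) (k * f x y) 1 := by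
    have h5 : HasDerivAt (fun c : ℝ => c ^ k * f x y) (k * f x y) 1 := by
      simpa using (hasDerivAt_pow k (1 : ℝ)).mul_const (f x y)
    refine h5.congr_of_eventuallyEq ?_
    filter_upwards [lt_mem_nhds one_pos] with c hc using hf c hc
  rw [← h2]
  exact h3.unique h4

lemma exists_represents_inv {M : Vec 2 → Vec 2 → Matrix (Fin 2) (Fin 2) ℝ}
    {g : Fin 2 → Fin 2 → smoothFun O} (hg : ∀ i j, Represents (fun x y => M x y i j) (g i j))
    (hM : ∀ x y, (x, y) ∈ O → (M x y).det ≠ 0) :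
    ∃ h : Fin 2 → Fin 2 → smoothFun O, ∀ i j, Represents (fun x y => (M x y)⁻¹ i j) (h i j) := by
  have hdet : Represents (fun x y => (M x y).det) (g 0 0 * g 1 1 - g 0 1 * g 1 0) :=
    (((hg 0 0).mul (hg 1 1)).sub ((hg 0 1).mul (hg 1 0))).congr fun x y _ =>
      Matrix.det_fin_two _
  obtain ⟨d, hd⟩ := hdet.exists_inv hM
  refine ⟨![![d * g 1 1, d * (0 - g 0 1)], ![d * (0 - g 1 0), d * g 0 0]], fun i j => ?_⟩
  have hinv : ∀ x y, (M x y)⁻¹ i j = ((M x y).det)⁻¹ *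
      !![M x y 1 1, - M x y 0 1; - M x y 1 0, M x y 0 0] i j := fun x y => by
    rw [Matrix.inv_def, Matrix.adjugate_fin_two]
    simp
  have hzero : Represents (fun _ _ => 0) (0 : smoothFun O) := fun _ _ _ => rfl
  fin_cases i <;> fin_cases j
  · exact (hd.mul (hg 1 1)).congr fun x y _ => by simpa using hinv x y
  · exact (hd.mul (hzero.sub (hg 0 1))).congr fun x y _ => by simpa using hinv x y
  · exact (hd.mul (hzero.sub (hg 1 0))).congr fun x y _ => by simpa using hinv x y
  · exact (hd.mul (hg 0 0)).congr fun x y _ => by simpa using hinv x y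

lemma two_mul_algebraMap_half {A : Type*} [CommRing A] [Algebra ℝ A] (a : A) :
    2 * (algebraMap ℝ A (1 / 2) * a) = a := by
  rw [← mul_assoc, ← map_ofNat (algebraMap ℝ A) 2, ← map_mul]
  norm_num

/-- The spray of a Finsler metric in the algebra of smooth functions: its coefficients are
2-homogeneous and the squared metric is 2-homogeneous and horizontally constant. -/
lemma exists_represents_sprayF {F : Vec 2 → Vec 2 → ℝ} {f : smoothFun O} (hf : Represents F f)
    (hhom : ∀ x y, (x, y) ∈ O → ∀ c : ℝ, 0 < c → F x (c • y) = c * F x y)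
    (hpos : ∀ x y, (x, y) ∈ O → (gmat F x y).PosDef) :
    ∃ G : Fin 2 → smoothFun O, (∀ i, Represents (sprayF F i) (G i)) ∧
      (∀ i, (jetFrame O).euler (G i) = 2 * G i) ∧
      (jetFrame O).euler (f * f) = 2 * (f * f) ∧ ∀ k, (jetFrame O).hor G k (f * f) = 0 := by
  set C := jetFrame O
  have hL : Represents (Fsq F) (f * f) := (hf.mul hf).congr fun x y _ => pow_two _
  have hEL : C.euler (f * f) = 2 * (f * f) := by
    refine (Represents.sum fun m => (Represents.jetFrame_y m).mul (hL.jetFrame_Y m)).eq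
      (((Represents.ofNat 2).mul hL).congr fun x y h => ?_)
    have := sum_mul_pdy_of_homogeneous hL h 2 fun c hc => by
      simp only [Fsq, hhom x y h c hc]
      ring
    exact_mod_cast this
  set g : Fin 2 → Fin 2 → smoothFun O :=
    fun i l => algebraMap ℝ _ (1 / 2) * C.Y l (C.Y i (f * f))
  have hgR : ∀ i l, Represents (fun x y => gmat F x y i l) (g i l) := fun i l =>
    (Represents.const (1 / 2)).mul ((hL.jetFrame_Y i).jetFrame_Y l)
  have hg : ∀ i l, 2 * g i l = C.Y l (C.Y i (f * f)) := fun i l => two_mul_algebraMap_half _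
  obtain ⟨h, hh⟩ := exists_represents_inv hgR fun x y hxy => (hpos x y hxy).det_pos.ne'
  have hhg : ∀ i j, ∑ l, h i l * g l j = if i = j then 1 else 0 := fun i j => by
    refine (Represents.sum fun l => (hh i l).mul (hgR l j)).eq
      ((Represents.kronecker i j).congr fun x y hxy => ?_)
    rw [← Matrix.mul_apply, Matrix.nonsing_inv_mul _ (hpos x y hxy).det_pos.ne'.isUnit,
      Matrix.one_apply]
  have hgh : ∀ i j, ∑ l, g i l * h l j = if i = j then 1 else 0 := fun i j => by
    refine (Represents.sum fun l => (hgR i l).mul (hh l j)).eq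
      ((Represents.kronecker i j).congr fun x y hxy => ?_)
    rw [← Matrix.mul_apply, Matrix.mul_nonsing_inv _ (hpos x y hxy).det_pos.ne'.isUnit,
      Matrix.one_apply]
  set B : Fin 2 → smoothFun O :=
    fun l => ∑ k, C.y k * C.Y l (C.X k (f * f)) - C.X l (f * f)
  set G : Fin 2 → smoothFun O := fun i => algebraMap ℝ _ (1 / 4) * ∑ l, h i l * B l with hGdef
  have hG : ∀ l, 4 * ∑ i, g l i * G i = B l := fun l => by
    have h4 : algebraMap ℝ (smoothFun O) (1 / 4) * 4 = 1 := by
      rw [← map_ofNat (algebraMap ℝ (smoothFun O)) 4, ← map_mul]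
      norm_num
    have h0 := hgh l 0
    have h1 := hgh l 1
    simp only [hGdef, Fin.sum_univ_two] at h0 h1 ⊢
    have hB : B l = (if l = 0 then 1 else 0) * B 0 + (if l = 1 then 1 else 0) * B 1 := by
      fin_cases l <;> simp
    rw [hB]
    linear_combination B 0 * h0 + B 1 * h1 +
      (g l 0 * (h 0 0 * B 0 + h 0 1 * B 1) + g l 1 * (h 1 0 * B 0 + h 1 1 * B 1)) * h4
  have hGhom := C.spray_homogeneous hEL hg hhg hG
  refine ⟨G, fun i => ?_, hGhom, hEL, fun k => ?_⟩
  · exact (Represents.const (1 / 4)).mul (Represents.sum fun l => (hh i l).mul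
      ((Represents.sum fun k => (Represents.jetFrame_y k).mul
        ((hL.jetFrame_X k).jetFrame_Y l)).sub (hL.jetFrame_X l)))
  · exact C.hor_eq_zero hEL (C.spray_Y_of_metric hg hG) k

end Finsler

/-- Corollary 3.2: a two-dimensional Finsler metric of constant flag curvature has
vanishing Berwald–Weyl curvature for every volume form. -/
theorem stmt_6 (U : Set (Vec 2)) (hU : IsOpen U) (hUne : U.Nonempty)
    (F : Vec 2 → Vec 2 → ℝ) (hF : IsFinsler U F) (K : ℝ)
    (hK : ∀ x ∈ U, ∀ y ∈ slit 2, ∀ i k : Fin 2,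
      Riem (sprayF F) i k x y =
        K * ((F x y) ^ 2 * (if i = k then 1 else 0) - F x y * pdy F k x y * y i)) :
    ∀ σ : Vec 2 → ℝ, IsVolumeForm U σ →
      ∀ x ∈ U, ∀ y ∈ slit 2, ∀ k : Fin 2, BWeyl (sprayF F) σ k x y = 0 := by
  intro σ hσ x hx y hy k
  have hopen : IsOpen (U ×ˢ slit 2) := hU.prod isOpen_ne
  let O : TopologicalSpace.Opens (Vec 2 × Vec 2) := ⟨U ×ˢ slit 2, hopen⟩
  have hmem : ∀ x y, (x, y) ∈ O → x ∈ U ∧ y ∈ slit 2 := fun x y h => h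
  set C := jetFrame O
  obtain ⟨f, hf⟩ : ∃ f : smoothFun O, Represents F f := exists_represents hF.1
  obtain ⟨G, hGR, hG, hEL, hL⟩ := exists_represents_sprayF hf
    (fun x y h => hF.2.2.1 x (hmem x y h).1 y (hmem x y h).2)
    (fun x y h => hF.2.2.2 x (hmem x y h).1 y (hmem x y h).2)
  obtain ⟨ℓ, hℓR⟩ : ∃ ℓ : smoothFun O, Represents (fun x _ => Real.log (σ x)) ℓ :=
    exists_represents <| (hσ.1.log fun x hx => (hσ.2 x hx).ne').comp contDiffOn_fst fun p hp => hp.1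
  have hℓ : ∀ k, C.Y k ℓ = 0 := fun k => (hℓR.jetFrame_Y k).eq fun x y _ => by
    simp [pdy]
  have hR : ∀ i k, 2 * C.riem G i k = algebraMap ℝ (smoothFun O) K *
      (2 * (f * f) * (if i = k then 1 else 0) - C.Y k (f * f) * C.y i) := fun i k => by
    have h : C.riem G i k = algebraMap ℝ (smoothFun O) K *
        (f * f * (if i = k then 1 else 0) - f * C.Y k f * C.y i) :=
      (Represents.riem hGR i k).eq <|
        ((Represents.const K).mul (((hf.mul hf).mul (Represents.kronecker i k)).sub
          ((hf.mul (hf.jetFrame_Y k)).mul (Represents.jetFrame_y i)))).congr fun x y hxy => by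
        rw [hK x (hmem x y hxy).1 y (hmem x y hxy).2, pow_two]
    rw [h, Derivation.leibniz, smul_eq_mul]
    ring
  set S := ∑ m, C.Y m (G m) - ∑ m, C.y m * C.X m ℓ with hS
  have hSR : Represents (Scurv (sprayF F) σ) S :=
    (Represents.sum fun m => (hGR m).jetFrame_Y m).sub
      (Represents.sum fun m => (Represents.jetFrame_y m).mul (hℓR.jetFrame_X m))
  set P := algebraMap ℝ (smoothFun O) (-1 / 3) * S with hPdef
  have hP : C.euler P = P := by
    have h : C.euler P = algebraMap ℝ (smoothFun O) (-1 / 3) * C.euler S := by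
      simp [CoordFrame.euler, Fin.sum_univ_two, hPdef]
      ring
    rw [h, hS, C.euler_Scurv hG hℓ]
  have hχ : ∀ k, C.Y k (C.spray G P) = 2 * C.hor G k P := fun k => by
    have h1 : C.spray G P = algebraMap ℝ (smoothFun O) (-1 / 3) * C.spray G S := by
      simp [CoordFrame.spray, Fin.sum_univ_two, hPdef]
      ring
    have h2 : C.hor G k P = algebraMap ℝ (smoothFun O) (-1 / 3) * C.hor G k S := by
      simp [CoordFrame.hor, Fin.sum_univ_two, hPdef]
      ring
    rw [h1, h2, Derivation.leibniz, Derivation.map_algebraMap, hS, C.Y_spray_Scurv hℓ hEL hR]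
    simp only [smul_eq_mul]
    ring
  have hGhat : ∀ i, Represents (Ghat (sprayF F) σ i) (G i + P * C.y i) := fun i =>
    ((hGR i).add (((Represents.const (-1 / 3)).mul hSR).mul (Represents.jetFrame_y i))).congr
      fun x y _ => by
        simp only [Ghat]
        push_cast
        ring
  have hBW : Represents (BWeyl (sprayF F) σ k) _ :=
    (Represents.hor hGhat (Represents.ricci hGhat) k).sub
      ((Represents.const (1 / 2)).mul (Represents.contrCov hGhat (Represents.ricci hGhat) k))
  have hzero := C.berwaldWeyl_projective hG hP hχ hEL hL hR k
  have hBW0 : Represents (BWeyl (sprayF F) σ k) (0 : smoothFun O) := by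
    convert hBW using 1
    refine CoordFrame.two_mul_cancel ?_
    rw [mul_sub, two_mul_algebraMap_half, hzero, mul_zero]
  exact (hBW0 x y ⟨hx, hy⟩).symm

end BerwaldWeyl
end

section
/- Let G be a spray on a nonempty open set U ⊆ ℝ^n (n ≥ 2) and dV a volume form on U with S-curvature S. Then the two expressions for the χ-curvature agree: −(1/3) T^m_{i·m} = ½ (S_{·i|m} y^m − S_{|i}) on U × (ℝ^n \ {0}), where T^i_k := R^i_k − (R δ^i_k − ½ R_{·k} y^i) and '|' is the horizontal covariant derivative with respect to G. In particular the right-hand side does not depend on the choice of dV. -/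
open scoped BigOperators
open MeasureTheory

noncomputable section BerwaldWeyl

/-- Smoothness of `f(x,y)` on `U × (ℝⁿ \ {0})`. -/
def SmoothSlit {n : ℕ} (U : Set (Vec n)) (f : Vec n → Vec n → ℝ) : Prop :=
  ContDiffOn ℝ (⊤ : ℕ∞) (fun p : Vec n × Vec n => f p.1 p.2) (U ×ˢ slit n)

/-- Positive `k`-homogeneity in `y` on `U × (ℝⁿ \ {0})`. -/
def HomogSlit {n : ℕ} (U : Set (Vec n)) (k : ℕ) (f : Vec n → Vec n → ℝ) : Prop :=
  ∀ x ∈ U, ∀ y ∈ slit n, ∀ c : ℝ, 0 < c → f x (c • y) = c ^ k * f x y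

section Calculus

variable {n : ℕ} {U : Set (Vec n)} {f g : Vec n → Vec n → ℝ} {x y : Vec n}

lemma isOpen_slit : IsOpen (slit n) := isOpen_ne

lemma isOpen_prod_slit (hU : IsOpen U) : IsOpen (U ×ˢ slit n) := hU.prod isOpen_slit

namespace SmoothSlit

lemma contDiffAt (hf : SmoothSlit U f) (hU : IsOpen U) (hx : x ∈ U) (hy : y ∈ slit n) :
    ContDiffAt ℝ (⊤ : ℕ∞) (fun p : Vec n × Vec n => f p.1 p.2) (x, y) :=
  ContDiffOn.contDiffAt hf ((isOpen_prod_slit hU).mem_nhds ⟨hx, hy⟩)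

lemma differentiableAt (hf : SmoothSlit U f) (hU : IsOpen U) (hx : x ∈ U) (hy : y ∈ slit n) :
    DifferentiableAt ℝ (fun p : Vec n × Vec n => f p.1 p.2) (x, y) :=
  (hf.contDiffAt hU hx hy).differentiableAt (by simp)

lemma differentiableAt_left (hf : SmoothSlit U f) (hU : IsOpen U) (hx : x ∈ U)
    (hy : y ∈ slit n) : DifferentiableAt ℝ (fun x' => f x' y) x :=
  DifferentiableAt.comp (f := fun x' : Vec n => (x', y)) x (hf.differentiableAt hU hx hy)
    (by fun_prop)

lemma differentiableAt_right (hf : SmoothSlit U f) (hU : IsOpen U) (hx : x ∈ U)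
    (hy : y ∈ slit n) : DifferentiableAt ℝ (fun y' => f x y') y :=
  DifferentiableAt.comp (f := fun y' : Vec n => (x, y')) y (hf.differentiableAt hU hx hy)
    (by fun_prop)

lemma pdx_eq (hf : SmoothSlit U f) (hU : IsOpen U) (hx : x ∈ U) (hy : y ∈ slit n) (i : Fin n) :
    pdx f i x y =
      fderiv ℝ (fun p : Vec n × Vec n => f p.1 p.2) (x, y) (Pi.single i 1, 0) := by
  have h := HasFDerivAt.comp (f := fun x' : Vec n => (x', y)) x
    (hf.differentiableAt hU hx hy).hasFDerivAt (hasFDerivAt_prodMk_left x y)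
  exact congrArg (fun L => L (Pi.single i 1)) h.fderiv

lemma pdy_eq (hf : SmoothSlit U f) (hU : IsOpen U) (hx : x ∈ U) (hy : y ∈ slit n) (i : Fin n) :
    pdy f i x y =
      fderiv ℝ (fun p : Vec n × Vec n => f p.1 p.2) (x, y) (0, Pi.single i 1) := by
  have h := (hf.differentiableAt hU hx hy).hasFDerivAt.comp y (hasFDerivAt_prodMk_right x y)
  exact congrArg (fun L => L (Pi.single i 1)) h.fderiv

lemma fderiv_apply (hf : SmoothSlit U f) (hU : IsOpen U) (v : Vec n × Vec n) :
    ContDiffOn ℝ (⊤ : ℕ∞)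
      (fun p => fderiv ℝ (fun p : Vec n × Vec n => f p.1 p.2) p v) (U ×ˢ slit n) :=
  (ContDiffOn.fderiv_of_isOpen hf (isOpen_prod_slit hU) (by simp)).clm_apply contDiffOn_const

lemma pdx (hf : SmoothSlit U f) (hU : IsOpen U) (i : Fin n) : SmoothSlit U (pdx f i) :=
  (hf.fderiv_apply hU (Pi.single i 1, 0)).congr fun _ hp => hf.pdx_eq hU hp.1 hp.2 i

lemma pdy (hf : SmoothSlit U f) (hU : IsOpen U) (i : Fin n) : SmoothSlit U (pdy f i) :=
  (hf.fderiv_apply hU (0, Pi.single i 1)).congr fun _ hp => hf.pdy_eq hU hp.1 hp.2 i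

lemma add (hf : SmoothSlit U f) (hg : SmoothSlit U g) :
    SmoothSlit U (fun x y => f x y + g x y) := ContDiffOn.add hf hg

lemma sub (hf : SmoothSlit U f) (hg : SmoothSlit U g) :
    SmoothSlit U (fun x y => f x y - g x y) := ContDiffOn.sub hf hg

lemma mul (hf : SmoothSlit U f) (hg : SmoothSlit U g) :
    SmoothSlit U (fun x y => f x y * g x y) := ContDiffOn.mul hf hg

lemma const (c : ℝ) : SmoothSlit U (fun _ _ => c) := contDiffOn_const

lemma coord (j : Fin n) : SmoothSlit U (fun _ y => y j) := by
  unfold SmoothSlit; fun_prop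

lemma sum {ι : Type*} {s : Finset ι} {F : ι → Vec n → Vec n → ℝ}
    (hF : ∀ j, SmoothSlit U (F j)) : SmoothSlit U (fun x y => ∑ j ∈ s, F j x y) :=
  ContDiffOn.sum fun j _ => hF j

/-- Second derivatives of a function smooth on `U × (ℝⁿ \ {0})` commute. -/
lemma fderiv_comm (hf : SmoothSlit U f) (hU : IsOpen U) (hx : x ∈ U) (hy : y ∈ slit n)
    (v w : Vec n × Vec n) :
    fderiv ℝ (fun p => fderiv ℝ (fun p : Vec n × Vec n => f p.1 p.2) p v) (x, y) w =
      fderiv ℝ (fun p => fderiv ℝ (fun p : Vec n × Vec n => f p.1 p.2) p w) (x, y) v := by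
  have hd : DifferentiableAt ℝ (fderiv ℝ (fun p : Vec n × Vec n => f p.1 p.2)) (x, y) :=
    ((hf.contDiffAt hU hx hy).fderiv_right (m := 1) (by norm_cast)).differentiableAt (by simp)
  have hs : IsSymmSndFDerivAt ℝ (fun p : Vec n × Vec n => f p.1 p.2) (x, y) :=
    (hf.contDiffAt hU hx hy).isSymmSndFDerivAt (by simp; norm_cast)
  rw [fderiv_clm_apply hd (by fun_prop), fderiv_clm_apply hd (by fun_prop)]
  simpa using hs.eq w v

end SmoothSlit

lemma pdx_congr (hU : IsOpen U) (h : ∀ x ∈ U, ∀ y ∈ slit n, f x y = g x y)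
    (hx : x ∈ U) (hy : y ∈ slit n) (i : Fin n) : pdx f i x y = pdx g i x y := by
  have : (fun x' => f x' y) =ᶠ[nhds x] fun x' => g x' y := by
    filter_upwards [hU.mem_nhds hx] with x' hx' using h x' hx' y hy
  simp only [pdx, this.fderiv_eq]

lemma pdy_congr (h : ∀ x ∈ U, ∀ y ∈ slit n, f x y = g x y)
    (hx : x ∈ U) (hy : y ∈ slit n) (i : Fin n) : pdy f i x y = pdy g i x y := by
  have : (fun y' => f x y') =ᶠ[nhds y] fun y' => g x y' := by
    filter_upwards [isOpen_slit.mem_nhds hy] with y' hy' using h x hx y' hy'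
  simp only [pdy, this.fderiv_eq]

lemma fderiv_congr_slit {f g : Vec n × Vec n → ℝ} (hU : IsOpen U)
    (h : ∀ p ∈ U ×ˢ slit n, f p = g p) (hx : x ∈ U) (hy : y ∈ slit n) :
    fderiv ℝ f (x, y) = fderiv ℝ g (x, y) := by
  apply Filter.EventuallyEq.fderiv_eq
  filter_upwards [(isOpen_prod_slit hU).mem_nhds ⟨hx, hy⟩] with p hp using h p hp

lemma pdy_comm (hf : SmoothSlit U f) (hU : IsOpen U) (hx : x ∈ U) (hy : y ∈ slit n)
    (i j : Fin n) : pdy (pdy f i) j x y = pdy (pdy f j) i x y := by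
  rw [(hf.pdy hU i).pdy_eq hU hx hy, (hf.pdy hU j).pdy_eq hU hx hy,
    fderiv_congr_slit hU (fun p hp => hf.pdy_eq hU hp.1 hp.2 i) hx hy,
    fderiv_congr_slit hU (fun p hp => hf.pdy_eq hU hp.1 hp.2 j) hx hy]
  exact hf.fderiv_comm hU hx hy _ _

lemma pdx_comm (hf : SmoothSlit U f) (hU : IsOpen U) (hx : x ∈ U) (hy : y ∈ slit n)
    (i j : Fin n) : pdx (pdx f i) j x y = pdx (pdx f j) i x y := by
  rw [(hf.pdx hU i).pdx_eq hU hx hy, (hf.pdx hU j).pdx_eq hU hx hy,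
    fderiv_congr_slit hU (fun p hp => hf.pdx_eq hU hp.1 hp.2 i) hx hy,
    fderiv_congr_slit hU (fun p hp => hf.pdx_eq hU hp.1 hp.2 j) hx hy]
  exact hf.fderiv_comm hU hx hy _ _

lemma pdy_pdx_comm (hf : SmoothSlit U f) (hU : IsOpen U) (hx : x ∈ U) (hy : y ∈ slit n)
    (i j : Fin n) : pdy (pdx f i) j x y = pdx (pdy f j) i x y := by
  rw [(hf.pdx hU i).pdy_eq hU hx hy, (hf.pdy hU j).pdx_eq hU hx hy,
    fderiv_congr_slit hU (fun p hp => hf.pdx_eq hU hp.1 hp.2 i) hx hy,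
    fderiv_congr_slit hU (fun p hp => hf.pdy_eq hU hp.1 hp.2 j) hx hy]
  exact hf.fderiv_comm hU hx hy _ _

lemma pdy_add (hf : SmoothSlit U f) (hg : SmoothSlit U g) (hU : IsOpen U) (hx : x ∈ U)
    (hy : y ∈ slit n) (i : Fin n) :
    pdy (fun x y => f x y + g x y) i x y = pdy f i x y + pdy g i x y := by
  simp only [pdy]
  rw [fderiv_fun_add (hf.differentiableAt_right hU hx hy) (hg.differentiableAt_right hU hx hy)]
  rfl

lemma pdy_sub (hf : SmoothSlit U f) (hg : SmoothSlit U g) (hU : IsOpen U) (hx : x ∈ U)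
    (hy : y ∈ slit n) (i : Fin n) :
    pdy (fun x y => f x y - g x y) i x y = pdy f i x y - pdy g i x y := by
  simp only [pdy]
  rw [fderiv_fun_sub (hf.differentiableAt_right hU hx hy) (hg.differentiableAt_right hU hx hy)]
  rfl

lemma pdx_sub (hf : SmoothSlit U f) (hg : SmoothSlit U g) (hU : IsOpen U) (hx : x ∈ U)
    (hy : y ∈ slit n) (i : Fin n) :
    pdx (fun x y => f x y - g x y) i x y = pdx f i x y - pdx g i x y := by
  simp only [pdx]
  rw [fderiv_fun_sub (hf.differentiableAt_left hU hx hy) (hg.differentiableAt_left hU hx hy)]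
  rfl

lemma pdy_mul (hf : SmoothSlit U f) (hg : SmoothSlit U g) (hU : IsOpen U) (hx : x ∈ U)
    (hy : y ∈ slit n) (i : Fin n) :
    pdy (fun x y => f x y * g x y) i x y = pdy f i x y * g x y + f x y * pdy g i x y := by
  simp only [pdy]
  rw [fderiv_fun_mul (hf.differentiableAt_right hU hx hy) (hg.differentiableAt_right hU hx hy)]
  simp only [add_apply, smul_apply, smul_eq_mul]
  ring

lemma pdx_mul (hf : SmoothSlit U f) (hg : SmoothSlit U g) (hU : IsOpen U) (hx : x ∈ U)
    (hy : y ∈ slit n) (i : Fin n) :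
    pdx (fun x y => f x y * g x y) i x y = pdx f i x y * g x y + f x y * pdx g i x y := by
  simp only [pdx]
  rw [fderiv_fun_mul (hf.differentiableAt_left hU hx hy) (hg.differentiableAt_left hU hx hy)]
  simp only [add_apply, smul_apply, smul_eq_mul]
  ring

lemma pdy_sum {ι : Type*} {s : Finset ι} {F : ι → Vec n → Vec n → ℝ}
    (hF : ∀ j, SmoothSlit U (F j)) (hU : IsOpen U) (hx : x ∈ U) (hy : y ∈ slit n) (i : Fin n) :
    pdy (fun x y => ∑ j ∈ s, F j x y) i x y = ∑ j ∈ s, pdy (F j) i x y := by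
  simp only [pdy]
  rw [fderiv_fun_sum fun j _ => (hF j).differentiableAt_right hU hx hy]
  simp

lemma pdx_sum {ι : Type*} {s : Finset ι} {F : ι → Vec n → Vec n → ℝ}
    (hF : ∀ j, SmoothSlit U (F j)) (hU : IsOpen U) (hx : x ∈ U) (hy : y ∈ slit n) (i : Fin n) :
    pdx (fun x y => ∑ j ∈ s, F j x y) i x y = ∑ j ∈ s, pdx (F j) i x y := by
  simp only [pdx]
  rw [fderiv_fun_sum fun j _ => (hF j).differentiableAt_left hU hx hy]
  simp

lemma pdy_const_left (h : Vec n → ℝ) (i : Fin n) (x y : Vec n) :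
    pdy (fun x _ => h x) i x y = 0 := by
  simp [pdy]

lemma pdx_const_right (h : Vec n → ℝ) (i : Fin n) (x y : Vec n) :
    pdx (fun _ y => h y) i x y = 0 := by
  simp [pdx]

lemma pdy_coord (j i : Fin n) (x y : Vec n) :
    pdy (fun _ y => y j) i x y = if j = i then 1 else 0 := by
  have : fderiv ℝ (fun y' : Vec n => y' j) y = ContinuousLinearMap.proj j :=
    (ContinuousLinearMap.proj (R := ℝ) (φ := fun _ : Fin n => ℝ) j).fderiv
  simp [pdy, this, Pi.single_apply]

namespace HomogSlit

variable {k l : ℕ}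

lemma add (hf : HomogSlit U k f) (hg : HomogSlit U k g) :
    HomogSlit U k (fun x y => f x y + g x y) := fun x hx y hy c hc => by
  simp only [hf x hx y hy c hc, hg x hx y hy c hc]; ring

lemma sub (hf : HomogSlit U k f) (hg : HomogSlit U k g) :
    HomogSlit U k (fun x y => f x y - g x y) := fun x hx y hy c hc => by
  simp only [hf x hx y hy c hc, hg x hx y hy c hc]; ring

lemma mul (hf : HomogSlit U k f) (hg : HomogSlit U l g) :
    HomogSlit U (k + l) (fun x y => f x y * g x y) := fun x hx y hy c hc => by
  simp only [hf x hx y hy c hc, hg x hx y hy c hc]; ring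

lemma const_mul (a : ℝ) (hf : HomogSlit U k f) :
    HomogSlit U k (fun x y => a * f x y) := fun x hx y hy c hc => by
  simp only [hf x hx y hy c hc]; ring

lemma coord (j : Fin n) : HomogSlit U 1 (fun _ y => y j) := fun x hx y hy c hc => by
  simp

lemma sum {ι : Type*} {s : Finset ι} {F : ι → Vec n → Vec n → ℝ}
    (hF : ∀ j, HomogSlit U k (F j)) : HomogSlit U k (fun x y => ∑ j ∈ s, F j x y) :=
  fun x hx y hy c hc => by
    simp only [fun j => hF j x hx y hy c hc, Finset.mul_sum]

lemma pdx (hf : HomogSlit U k f) (hs : SmoothSlit U f) (hU : IsOpen U) (i : Fin n) :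
    HomogSlit U k (pdx f i) := fun x hx y hy c hc => by
  have : (fun x' => f x' (c • y)) =ᶠ[nhds x] fun x' => c ^ k * f x' y := by
    filter_upwards [hU.mem_nhds hx] with x' hx' using hf x' hx' y hy c hc
  simp only [_root_.pdx, this.fderiv_eq]
  rw [fderiv_const_mul (hs.differentiableAt_left hU hx hy)]
  simp

lemma pdy (hf : HomogSlit U (k + 1) f) (hs : SmoothSlit U f) (hU : IsOpen U) (i : Fin n) :
    HomogSlit U k (pdy f i) := fun x hx y hy c hc => by
  have : (fun y' => f x (c • y')) =ᶠ[nhds y] fun y' => c ^ (k + 1) * f x y' := by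
    filter_upwards [isOpen_slit.mem_nhds hy] with y' hy' using hf x hx y' hy' c hc
  have h1 := this.fderiv_eq (𝕜 := ℝ)
  rw [fderiv_const_mul (hs.differentiableAt_right hU hx hy), fderiv_comp_smul] at h1
  have h2 := congrArg (fun L => L (Pi.single i 1)) h1
  simp only [smul_apply, smul_eq_mul] at h2
  simp only [_root_.pdy]
  apply mul_left_cancel₀ hc.ne'
  rw [h2]; ring

/-- Euler's identity. -/
lemma euler (hf : HomogSlit U k f) (hs : SmoothSlit U f) (hU : IsOpen U) (hx : x ∈ U)
    (hy : y ∈ slit n) : ∑ m, _root_.pdy f m x y * y m = k * f x y := by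
  have h1 : HasDerivAt (fun c : ℝ => f x (c • y)) (fderiv ℝ (fun y' => f x y') y y) 1 := by
    have hd : HasFDerivAt (fun y' => f x y') (fderiv ℝ (fun y' => f x y') y) ((1 : ℝ) • y) := by
      simpa using (hs.differentiableAt_right hU hx hy).hasFDerivAt
    have hl : HasDerivAt (fun c : ℝ => c • y) y 1 := by
      simpa using (hasDerivAt_id (1 : ℝ)).smul_const y
    exact hd.comp_hasDerivAt 1 hl
  have h2 : HasDerivAt (fun c : ℝ => c ^ k * f x y) (k * f x y) 1 := by
    simpa using (hasDerivAt_pow k (1 : ℝ)).mul_const (f x y)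
  have h3 : (fun c : ℝ => f x (c • y)) =ᶠ[nhds 1] fun c => c ^ k * f x y := by
    filter_upwards [lt_mem_nhds zero_lt_one] with c hc using hf x hx y hy c hc
  rw [← h1.unique (h2.congr_of_eventuallyEq h3)]
  have h4 := map_sum (fderiv ℝ (fun y' => f x y') y) (fun m => (Pi.single m (y m) : Vec n))
    Finset.univ
  rw [Finset.univ_sum_single] at h4
  rw [h4]
  refine Finset.sum_congr rfl fun m _ => ?_
  have : (Pi.single m (y m) : Vec n) = y m • Pi.single m 1 := by
    rw [← Pi.single_smul]; simp
  rw [this, map_smul, smul_eq_mul, mul_comm]; rfl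

end HomogSlit

end Calculus

section Curvature

variable {n : ℕ} {U : Set (Vec n)} {G : Fin n → Vec n → Vec n → ℝ} {σ : Vec n → ℝ}
  {x y : Vec n}

lemma IsSpray.smooth (hG : IsSpray U G) (i : Fin n) : SmoothSlit U (G i) := hG.1 i

lemma IsSpray.homog (hG : IsSpray U G) (i : Fin n) : HomogSlit U 2 (G i) := hG.2 i

lemma IsSpray.smooth_Nc (hG : IsSpray U G) (hU : IsOpen U) (i j : Fin n) :
    SmoothSlit U (Nc G i j) := (hG.smooth i).pdy hU j

lemma IsSpray.smooth_Γc (hG : IsSpray U G) (hU : IsOpen U) (i j k : Fin n) :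
    SmoothSlit U (Γc G i j k) := (hG.smooth_Nc hU i j).pdy hU k

lemma IsSpray.homog_Nc (hG : IsSpray U G) (hU : IsOpen U) (i j : Fin n) :
    HomogSlit U 1 (Nc G i j) := (hG.homog i).pdy (hG.smooth i) hU j

lemma IsSpray.homog_Γc (hG : IsSpray U G) (hU : IsOpen U) (i j k : Fin n) :
    HomogSlit U 0 (Γc G i j k) := (hG.homog_Nc hU i j).pdy (hG.smooth_Nc hU i j) hU k

lemma IsSpray.Γc_symm (hG : IsSpray U G) (hU : IsOpen U) (hx : x ∈ U) (hy : y ∈ slit n)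
    (i j k : Fin n) : Γc G i j k x y = Γc G i k j x y :=
  pdy_comm (hG.smooth i) hU hx hy j k

lemma IsSpray.smooth_Riem (hG : IsSpray U G) (hU : IsOpen U) (i k : Fin n) :
    SmoothSlit U (Riem G i k) :=
  ((((SmoothSlit.const 2).mul ((hG.smooth i).pdx hU k)).sub
    (.sum fun j => (SmoothSlit.coord j).mul (((hG.smooth i).pdx hU j).pdy hU k))).add
    ((SmoothSlit.const 2).mul (.sum fun j => (hG.smooth j).mul (hG.smooth_Γc hU i j k)))).sub
    (.sum fun s => (hG.smooth_Nc hU i s).mul (hG.smooth_Nc hU s k))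

lemma IsSpray.homog_Riem (hG : IsSpray U G) (hU : IsOpen U) (i k : Fin n) :
    HomogSlit U 2 (Riem G i k) :=
  ((((hG.homog i).pdx (hG.smooth i) hU k).const_mul 2).sub
    (HomogSlit.sum fun j => (HomogSlit.coord j).mul
      (((hG.homog i).pdx (hG.smooth i) hU j).pdy ((hG.smooth i).pdx hU j) hU k))).add
    (HomogSlit.const_mul 2
      (HomogSlit.sum fun j => (hG.homog j).mul (hG.homog_Γc hU i j k))) |>.sub
    (HomogSlit.sum fun s => (hG.homog_Nc hU i s).mul (hG.homog_Nc hU s k))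

lemma IsSpray.smooth_Ricci (hG : IsSpray U G) (hU : IsOpen U) : SmoothSlit U (Ricci G) := by
  unfold Ricci
  simp only [div_eq_mul_inv]
  exact (SmoothSlit.sum fun m => hG.smooth_Riem hU m m).mul (.const _)

lemma IsSpray.homog_Ricci (hG : IsSpray U G) (hU : IsOpen U) : HomogSlit U 2 (Ricci G) := by
  unfold Ricci
  simp only [div_eq_inv_mul]
  exact (HomogSlit.sum fun m => hG.homog_Riem hU m m).const_mul _

lemma IsSpray.pdy_Ricci (hG : IsSpray U G) (hU : IsOpen U) (hn : 2 ≤ n) (hx : x ∈ U)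
    (hy : y ∈ slit n) (i : Fin n) :
    ((n : ℝ) - 1) * pdy (Ricci G) i x y = ∑ m, pdy (Riem G m m) i x y := by
  have hn' : (n : ℝ) - 1 ≠ 0 := by
    have : (2 : ℝ) ≤ n := by exact_mod_cast hn
    linarith
  have h : Ricci G = fun x y => (∑ m, Riem G m m x y) * ((n : ℝ) - 1)⁻¹ :=
    funext₂ fun _ _ => div_eq_mul_inv _ _
  rw [h, pdy_mul (.sum fun m => hG.smooth_Riem hU m m) (.const _) hU hx hy,
    pdy_sum (fun m => hG.smooth_Riem hU m m) hU hx hy,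
    pdy_const_left (fun _ => ((n : ℝ) - 1)⁻¹)]
  field_simp
  ring

/-- The vertical divergence of `T` in terms of `R^i_k`. -/
lemma IsSpray.sum_pdy_Tcurv (hG : IsSpray U G) (hU : IsOpen U) (hn : 2 ≤ n) (hx : x ∈ U)
    (hy : y ∈ slit n) (i : Fin n) :
    ∑ m, pdy (Tcurv G m i) m x y =
      ∑ m, pdy (Riem G m i) m x y + (1/2) * ∑ m, pdy (Riem G m m) i x y := by
  have hR := hG.smooth_Ricci hU
  have hRi := hR.pdy hU i
  have h (m : Fin n) : pdy (Tcurv G m i) m x y = pdy (Riem G m i) m x y -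
      (if m = i then pdy (Ricci G) m x y else 0) +
      (1/2) * (pdy (pdy (Ricci G) i) m x y * y m) + (1/2) * pdy (Ricci G) i x y := by
    unfold Tcurv
    rw [pdy_sub (hG.smooth_Riem hU m i) ((hR.mul (.const _)).sub
        (((SmoothSlit.const _).mul hRi).mul (.coord m))) hU hx hy,
      pdy_sub (hR.mul (.const _)) (((SmoothSlit.const _).mul hRi).mul (.coord m)) hU hx hy,
      pdy_mul hR (.const _) hU hx hy,
      pdy_mul ((SmoothSlit.const _).mul hRi) (.coord m) hU hx hy,
      pdy_mul (.const _) hRi hU hx hy, pdy_coord,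
      pdy_const_left (fun _ => (1 / 2 : ℝ)), pdy_const_left (fun _ => if m = i then (1 : ℝ) else 0)]
    simp only [↓reduceIte]
    split_ifs <;> ring
  have hE := HomogSlit.euler (k := 1) ((hG.homog_Ricci hU).pdy hR hU i) hRi hU hx hy
  simp only [h, Finset.sum_add_distrib, Finset.sum_sub_distrib, ← Finset.mul_sum, hE,
    ← hG.pdy_Ricci hU hn hx hy i]
  simp
  ring

lemma IsSpray.pdy_Riem (hG : IsSpray U G) (hU : IsOpen U) (hx : x ∈ U) (hy : y ∈ slit n)
    (a b c : Fin n) :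
    pdy (Riem G a b) c x y = 2 * pdx (Nc G a c) b x y - pdx (Nc G a b) c x y
      - ∑ j, y j * pdx (Γc G a b c) j x y
      + 2 * (∑ j, Nc G j c x y * Γc G a j b x y + ∑ j, G j x y * pdy (Γc G a j b) c x y)
      - (∑ s, Γc G a s c x y * Nc G s b x y + ∑ s, Nc G a s x y * Γc G s b c x y) := by
  have hN := hG.smooth_Nc hU
  have hΓ := hG.smooth_Γc hU
  have hX (j : Fin n) := (hG.smooth a).pdx hU j
  have h1 := (SmoothSlit.const (U := U) 2).mul (hX b)
  have h2 (j : Fin n) := (SmoothSlit.coord (U := U) j).mul ((hX j).pdy hU b)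
  have h3 (j : Fin n) := (hG.smooth j).mul (hΓ a j b)
  have h4 (s : Fin n) := (hN a s).mul (hN s b)
  have e1 (j : Fin n) : pdy (pdy (pdx (G a) j) b) c x y = pdx (Γc G a b c) j x y := by
    rw [pdy_congr (fun x hx y hy => pdy_pdx_comm (hG.smooth a) hU hx hy j b) hx hy]
    exact pdy_pdx_comm (hN a b) hU hx hy j c
  unfold Riem
  rw [pdy_sub ((h1.sub (.sum h2)).add ((SmoothSlit.const 2).mul (.sum h3))) (.sum h4) hU hx hy,
    pdy_add (h1.sub (.sum h2)) ((SmoothSlit.const 2).mul (.sum h3)) hU hx hy,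
    pdy_sub h1 (.sum h2) hU hx hy, pdy_mul (.const 2) (hX b) hU hx hy,
    pdy_mul (.const 2) (.sum h3) hU hx hy, pdy_sum h2 hU hx hy, pdy_sum h3 hU hx hy,
    pdy_sum h4 hU hx hy, pdy_const_left (fun _ => (2 : ℝ))]
  simp only [fun j => pdy_mul (SmoothSlit.coord j) ((hX j).pdy hU b) hU hx hy c,
    fun j => pdy_mul (hG.smooth j) (hΓ a j b) hU hx hy c,
    fun s => pdy_mul (hN a s) (hN s b) hU hx hy c, pdy_coord, e1, Finset.sum_add_distrib,
    pdy_pdx_comm (hG.smooth a) hU hx hy]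
  simp only [ite_mul, one_mul, zero_mul, Finset.sum_ite_eq', Finset.mem_univ, if_true]
  change _ + _ - (pdx (Nc G a b) c x y + _) + _ - (∑ s, Γc G a s c x y * _ + ∑ s, _ * Γc G s b c x y) = _
  change 0 + 2 * pdx (Nc G a c) b x y - _ + (_ + 2 * (∑ j, Nc G j c x y * _ + _)) - _ = _
  ring

lemma IsVolumeForm.smooth_log (hσ : IsVolumeForm U σ) :
    SmoothSlit U (fun x _ => Real.log (σ x)) :=
  (hσ.1.log fun x hx => (hσ.2 x hx).ne').comp contDiffOn_fst fun _ hp => hp.1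

lemma Scurv_eq : Scurv G σ = fun x y =>
    ∑ m, Nc G m m x y - ∑ m, y m * pdx (fun x _ => Real.log (σ x)) m x y := rfl

lemma IsSpray.pdy_Scurv (hG : IsSpray U G) (hU : IsOpen U) (hσ : IsVolumeForm U σ)
    (hx : x ∈ U) (hy : y ∈ slit n) (i : Fin n) :
    pdy (Scurv G σ) i x y =
      ∑ m, Γc G m m i x y - pdx (fun x _ => Real.log (σ x)) i x y := by
  have hF (m : Fin n) := hσ.smooth_log.pdx hU m
  have hz (m : Fin n) : pdy (pdx (fun x _ => Real.log (σ x)) m) i x y = 0 :=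
    pdy_const_left (fun x => pdx (fun x _ => Real.log (σ x)) m x y) i x y
  have h1 (m : Fin n) := (SmoothSlit.coord (U := U) m).mul (hF m)
  rw [Scurv_eq, pdy_sub (.sum fun m => hG.smooth_Nc hU m m) (.sum h1) hU hx hy,
    pdy_sum (fun m => hG.smooth_Nc hU m m) hU hx hy, pdy_sum h1 hU hx hy]
  simp only [fun m => pdy_mul (SmoothSlit.coord m) (hF m) hU hx hy i, pdy_coord, hz]
  simp [Γc, Nc]

lemma IsSpray.pdx_Scurv (hG : IsSpray U G) (hU : IsOpen U) (hσ : IsVolumeForm U σ)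
    (hx : x ∈ U) (hy : y ∈ slit n) (i : Fin n) :
    pdx (Scurv G σ) i x y = ∑ m, pdx (Nc G m m) i x y -
      ∑ m, y m * pdx (pdx (fun x _ => Real.log (σ x)) m) i x y := by
  have hF (m : Fin n) := hσ.smooth_log.pdx hU m
  have h1 (m : Fin n) := (SmoothSlit.coord (U := U) m).mul (hF m)
  rw [Scurv_eq, pdx_sub (.sum fun m => hG.smooth_Nc hU m m) (.sum h1) hU hx hy,
    pdx_sum (fun m => hG.smooth_Nc hU m m) hU hx hy, pdx_sum h1 hU hx hy]
  simp only [fun m => pdx_mul (SmoothSlit.coord m) (hF m) hU hx hy i,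
    fun m : Fin n => pdx_const_right (fun y : Vec n => y m)]
  simp

lemma IsSpray.pdx_pdy_Scurv (hG : IsSpray U G) (hU : IsOpen U) (hσ : IsVolumeForm U σ)
    (hx : x ∈ U) (hy : y ∈ slit n) (i j : Fin n) :
    pdx (pdy (Scurv G σ) i) j x y = ∑ m, pdx (Γc G m m i) j x y -
      pdx (pdx (fun x _ => Real.log (σ x)) i) j x y := by
  rw [pdx_congr hU (fun x hx y hy => hG.pdy_Scurv hU hσ hx hy i) hx hy,
    pdx_sub (.sum fun m => hG.smooth_Γc hU m m i) (hσ.smooth_log.pdx hU i) hU hx hy,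
    pdx_sum (fun m => hG.smooth_Γc hU m m i) hU hx hy]

lemma IsSpray.pdy_pdy_Scurv (hG : IsSpray U G) (hU : IsOpen U) (hσ : IsVolumeForm U σ)
    (hx : x ∈ U) (hy : y ∈ slit n) (i j : Fin n) :
    pdy (pdy (Scurv G σ) i) j x y = ∑ m, pdy (Γc G m m i) j x y := by
  rw [pdy_congr (fun x hx y hy => hG.pdy_Scurv hU hσ hx hy i) hx hy,
    pdy_sub (.sum fun m => hG.smooth_Γc hU m m i) (hσ.smooth_log.pdx hU i) hU hx hy,
    pdy_sum (fun m => hG.smooth_Γc hU m m i) hU hx hy]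
  exact sub_eq_self.2 (pdy_const_left (fun x => pdx (fun x _ => Real.log (σ x)) i x y) j x y)

/-- The expression `S_{·i|m} y^m - S_{|i}` written out: the connection terms combine by Euler's identity. -/
lemma IsSpray.covD1_Scurv (hG : IsSpray U G) (hU : IsOpen U)
    (hx : x ∈ U) (hy : y ∈ slit n) (i : Fin n) :
    ∑ m, covD1 G (fun j => pdy (Scurv G σ) j) i m x y * y m - hD G (Scurv G σ) i x y =
      ∑ m, pdx (pdy (Scurv G σ) i) m x y * y m
        - 2 * ∑ l, G l x y * pdy (pdy (Scurv G σ) i) l x y - pdx (Scurv G σ) i x y := by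
  have hN (l : Fin n) := (hG.homog l).euler (hG.smooth l) hU hx hy
  have hΓ (l : Fin n) := (hG.homog_Nc hU l i).euler (hG.smooth_Nc hU l i) hU hx hy
  have e1 : ∑ m, (∑ l, Nc G l m x y * pdy (pdy (Scurv G σ) i) l x y) * y m =
      2 * ∑ l, G l x y * pdy (pdy (Scurv G σ) i) l x y := by
    simp only [Finset.sum_mul, Finset.mul_sum]
    rw [Finset.sum_comm]
    refine Finset.sum_congr rfl fun l _ => ?_
    have h := congrArg (· * pdy (pdy (Scurv G σ) i) l x y) (hN l)
    simp only [Finset.sum_mul, Nat.cast_ofNat] at h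
    rw [← mul_assoc, ← h]
    exact Finset.sum_congr rfl fun m _ => by simp only [Nc]; ring
  have e2 : ∑ m, (∑ l, pdy (Scurv G σ) l x y * Γc G l i m x y) * y m =
      ∑ l, Nc G l i x y * pdy (Scurv G σ) l x y := by
    simp only [Finset.sum_mul]
    rw [Finset.sum_comm]
    refine Finset.sum_congr rfl fun l _ => ?_
    have h := congrArg (· * pdy (Scurv G σ) l x y) (hΓ l)
    simp only [Finset.sum_mul, Nat.cast_one, one_mul] at h
    rw [← h]
    exact Finset.sum_congr rfl fun m _ => by simp only [Γc, Nc]; ring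
  simp only [covD1, hD, sub_mul, Finset.sum_sub_distrib, e1, e2]
  ring

/-- In coordinates, `2 R^m_{i·m} + R^m_{m·i}` only involves `N^m_m` and its derivatives. -/
lemma IsSpray.sum_pdy_Riem (hG : IsSpray U G) (hU : IsOpen U) (hx : x ∈ U) (hy : y ∈ slit n)
    (i : Fin n) :
    2 * ∑ m, pdy (Riem G m i) m x y + ∑ m, pdy (Riem G m m) i x y =
      3 * ∑ m, pdx (Nc G m m) i x y - 3 * ∑ m, ∑ j, y j * pdx (Γc G m m i) j x y
        + 6 * ∑ m, ∑ j, G j x y * pdy (Γc G m m i) j x y := by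
  have hs (a b c : Fin n) : Γc G a b c x y = Γc G a c b x y := hG.Γc_symm hU hx hy a b c
  have hX (m j : Fin n) : pdx (Γc G m i m) j x y = pdx (Γc G m m i) j x y :=
    pdx_congr hU (fun x hx y hy => hG.Γc_symm hU hx hy m i m) hx hy j
  have hB1 (m j : Fin n) : pdy (Γc G m j m) i x y = pdy (Γc G m m i) j x y := by
    rw [pdy_congr (fun x hx y hy => hG.Γc_symm hU hx hy m j m) hx hy]
    exact pdy_comm (hG.smooth_Nc hU m m) hU hx hy j i
  have hB2 (m j : Fin n) : pdy (Γc G m j i) m x y = pdy (Γc G m m i) j x y := by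
    rw [← hB1]
    exact pdy_comm (hG.smooth_Nc hU m j) hU hx hy i m
  have h1 : ∑ m, ∑ j, Nc G j m x y * Γc G m j i x y =
      ∑ m, ∑ s, Nc G m s x y * Γc G s i m x y := by
    rw [Finset.sum_comm]
    simp only [fun a b => hs a b i]
  have h2 : ∑ m, ∑ s, Γc G m s i x y * Nc G s m x y =
      ∑ m, ∑ s, Nc G m s x y * Γc G s i m x y := by
    rw [← h1]
    simp only [mul_comm]
  have h3 : ∑ m, ∑ s, Nc G m s x y * Γc G s m i x y =
      ∑ m, ∑ s, Nc G m s x y * Γc G s i m x y := by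
    simp only [fun a b => hs a b i]
  have h4 : ∑ m, ∑ s, Γc G m s m x y * Nc G s i x y =
      ∑ m, ∑ s, Nc G s i x y * Γc G m s m x y := by
    simp only [mul_comm]
  simp only [hG.pdy_Riem hU hx hy, Finset.sum_add_distrib, Finset.sum_sub_distrib,
    ← Finset.mul_sum, hX, hB1, hB2]
  rw [h1, h2, h3, h4]
  ring

end Curvature

/-- Equation (2.13): the two expressions for the χ-curvature agree,
`-(1/3) T^m_{i·m} = ½ (S_{·i|m} y^m - S_{|i})`; in particular the right-hand side does
not depend on the choice of the volume form. -/
theorem stmt_9 {n : ℕ} (hn : 2 ≤ n) (U : Set (Vec n)) (hU : IsOpen U) (hUne : U.Nonempty)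
    (G : Fin n → Vec n → Vec n → ℝ) (hG : IsSpray U G)
    (σ : Vec n → ℝ) (hσ : IsVolumeForm U σ) :
    ∀ x ∈ U, ∀ y ∈ slit n, ∀ i : Fin n,
      -(1/3) * ∑ m, pdy (Tcurv G m i) m x y =
        (1/2) * (∑ m, covD1 G (fun j => pdy (Scurv G σ) j) i m x y * y m
          - hD G (Scurv G σ) i x y) := by
  intro x hx y hy i
  have hφ : ∑ m, pdx (pdx (fun x _ => Real.log (σ x)) i) m x y * y m =
      ∑ m, y m * pdx (pdx (fun x _ => Real.log (σ x)) m) i x y :=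
    Finset.sum_congr rfl fun m _ => by
      rw [pdx_comm hσ.smooth_log hU hx hy i m, mul_comm]
  have h1 : ∑ m, (∑ a, pdx (Γc G a a i) m x y) * y m =
      ∑ m, ∑ j, y j * pdx (Γc G m m i) j x y := by
    simp only [Finset.sum_mul]
    rw [Finset.sum_comm]
    simp only [mul_comm]
  have h2 : ∑ l, G l x y * ∑ a, pdy (Γc G a a i) l x y =
      ∑ m, ∑ j, G j x y * pdy (Γc G m m i) j x y := by
    simp only [Finset.mul_sum]
    exact Finset.sum_comm
  have hR := hG.sum_pdy_Riem hU hx hy i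
  rw [hG.sum_pdy_Tcurv hU hn hx hy, hG.covD1_Scurv hU hx hy, hG.pdx_Scurv hU hσ hx hy]
  simp only [hG.pdx_pdy_Scurv hU hσ hx hy, hG.pdy_pdy_Scurv hU hσ hx hy, sub_mul,
    Finset.sum_sub_distrib]
  rw [h1, h2, hφ]
  linarith

end BerwaldWeyl
end
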